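/- arXiv:2406.13620 — 5 statements merged into one kernel-verified Lean document; each statement's English description precedes it below -/
import Mathlib

section
/- In the QITU model in which every effective price function q_{ij} is piecewise linear with finitely many linear segments and every buyer's valuation v_i satisfies gross substitutes, there exists a competitive equilibrium, i.e., a feasible outcome (μ, p) such that μ(i) ∈ F_p(i) for every buyer i. -/
open Finset

variable {B S : Type*}

/-- Utility in the QITU model: valuation minus effective prices. -/
def qitUtil [DecidableEq S] (v : Finset S → ℝ) (q : S → ℝ → ℝ) (p : S → ℝ)
    (T : Finset S) : ℝ :=
  v T - ∑ j ∈ T, q j (p j)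

/-- `T` is a demanded set at (nonnegative) prices `p` in the QITU model. -/
def qitDemands [DecidableEq S] (v : Finset S → ℝ) (q : S → ℝ → ℝ) (p : S → ℝ)
    (T : Finset S) : Prop :=
  ∀ T' : Finset S, qitUtil v q p T' ≤ qitUtil v q p T

/-- Gross substitutes in the QITU model: for nonnegative price vectors `p ≤ p'`, any
demanded set at `p` keeps, inside some demanded set at `p'`, all items whose price
did not change. -/
def QITUGrossSubstitutes [DecidableEq S] (v : Finset S → ℝ) (q : S → ℝ → ℝ) : Prop :=
  ∀ p p' : S → ℝ, (∀ j, 0 ≤ p j) → (∀ j, p j ≤ p' j) →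
    ∀ T : Finset S, qitDemands v q p T →
      ∃ T' : Finset S, qitDemands v q p' T' ∧ ∀ j ∈ T, p j = p' j → j ∈ T'

/-- Piecewise linear with finitely many linear segments: away from a finite set of
breakpoints the function is locally affine. -/
def PiecewiseLinear (f : ℝ → ℝ) : Prop :=
  ∃ F : Finset ℝ, ∀ x : ℝ, x ∉ F → ∃ a b : ℝ, ∀ᶠ y in nhds x, f y = a * y + b

/-- Items matched to buyer `i` in a many-to-many matching. -/
def mmItems [DecidableEq B] [DecidableEq S] (μ : Finset (B × S)) (i : B) : Finset S :=
  (μ.filter fun e => e.1 = i).image Prod.snd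

/-- Number of buyers matched to item `j` in a many-to-many matching. -/
def mmDeg [DecidableEq S] (μ : Finset (B × S)) (j : S) : ℕ :=
  (μ.filter fun e => e.2 = j).card

open Filter Topology

/-- A strictly increasing piecewise linear function on the half-line is unbounded above. -/
lemma PiecewiseLinear.exists_lt {f : ℝ → ℝ} (hf : PiecewiseLinear f)
    (hmono : StrictMonoOn f (Set.Ici 0)) (K : ℝ) : ∃ x, 0 ≤ x ∧ K < f x := by
  obtain ⟨F, hF⟩ := hf
  obtain ⟨m, hm0, hm⟩ : ∃ m : ℝ, 0 ≤ m ∧ ∀ x ∈ F, x ≤ m := by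
    obtain ⟨m, hm⟩ := F.bddAbove
    exact ⟨max m 0, le_max_right _ _, fun x hx => (hm hx).trans (le_max_left _ _)⟩
  have hloc : ∀ x ∈ Set.Ioi m, ∃ a b : ℝ, f =ᶠ[𝓝 x] fun y => a * y + b :=
    fun x hx => hF x fun h => (hm x h).not_gt hx
  have haff : ∀ a b x : ℝ, HasDerivAt (fun y : ℝ => a * y + b) a x := fun a b x => by
    simpa using ((hasDerivAt_id x).const_mul a).add_const b
  have hderiv : ∀ x ∈ Set.Ioi m, ∃ a : ℝ, deriv f =ᶠ[𝓝 x] fun _ => a := fun x hx => by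
    obtain ⟨a, b, h⟩ := hloc x hx
    refine ⟨a, h.deriv.trans (Eventually.of_forall fun y => (haff a b y).deriv)⟩
  have hconst : ∃ a, ∀ x ∈ Set.Ioi m, deriv f x = a :=
    isOpen_Ioi.exists_is_const_of_deriv_eq_zero isPreconnected_Ioi
      (fun x hx => by
        obtain ⟨a, h⟩ := hderiv x hx
        exact (h.differentiableAt_iff.2 (differentiableAt_const a)).differentiableWithinAt)
      (fun x hx => by
        obtain ⟨a, h⟩ := hderiv x hx
        simp [h.deriv_eq])
  obtain ⟨a, ha⟩ := hconst
  have hdiff : ∀ x ∈ Set.Ioi m, HasDerivAt f a x := fun x hx => by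
    obtain ⟨c, b, h⟩ := hloc x hx
    have h1 : DifferentiableAt ℝ f x := h.differentiableAt_iff.2 (haff c b x).differentiableAt
    simpa [ha x hx] using h1.hasDerivAt
  have hsub : ∀ x ∈ Set.Ioi m, HasDerivAt (fun y => f y - a * y) 0 x := fun x hx => by
    simpa using (hdiff x hx).fun_sub ((hasDerivAt_id' x).const_mul a)
  obtain ⟨b, hb⟩ : ∃ b, ∀ x ∈ Set.Ioi m, f x - a * x = b :=
    isOpen_Ioi.exists_is_const_of_deriv_eq_zero isPreconnected_Ioi
      (fun x hx => (hsub x hx).differentiableAt.differentiableWithinAt)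
      (fun x hx => (hsub x hx).deriv)
  have hapos : 0 < a := by
    have h1 := hb (m + 1) (by simp)
    have h2 := hb (m + 2) (by simp)
    have h3 : f (m + 1) < f (m + 2) :=
      hmono (by simp; linarith) (by simp; linarith) (by linarith)
    linarith
  refine ⟨max (m + 1) ((K - b) / a + 1), le_max_of_le_left (by linarith), ?_⟩
  have h1 := hb (max (m + 1) ((K - b) / a + 1)) (lt_max_of_lt_left (lt_add_one m))
  have h2 : a * ((K - b) / a + 1) ≤ a * max (m + 1) ((K - b) / a + 1) :=
    mul_le_mul_of_nonneg_left (le_max_right _ _) hapos.le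
  have h3 : a * ((K - b) / a + 1) = K - b + a := by field_simp
  linarith

/-- Some bundle is demanded at any prices. -/
lemma exists_qitDemands [Fintype S] [DecidableEq S] (v : Finset S → ℝ) (q : S → ℝ → ℝ)
    (p : S → ℝ) : ∃ T, qitDemands v q p T :=
  Finite.exists_max (qitUtil v q p)

/-- A demanded bundle stays demanded when its own items become cheaper and all other items
become more expensive. -/
lemma qitDemands.of_le [DecidableEq S] {v : Finset S → ℝ} {q : S → ℝ → ℝ} {p p' : S → ℝ}
    {T : Finset S} (h : qitDemands v q p T) (hin : ∀ j ∈ T, q j (p' j) ≤ q j (p j))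
    (hout : ∀ j ∉ T, q j (p j) ≤ q j (p' j)) : qitDemands v q p' T := by
  intro T'
  have h1 := h T'
  have h2 : ∑ j ∈ T', (q j (p j) - q j (p' j)) ≤ ∑ j ∈ T, (q j (p j) - q j (p' j)) := by
    rw [← Finset.sum_inter_add_sum_sdiff T' T]
    have h3 : ∑ j ∈ T' \ T, (q j (p j) - q j (p' j)) ≤ 0 :=
      Finset.sum_nonpos fun j hj => sub_nonpos.2 (hout j (Finset.mem_sdiff.1 hj).2)
    have h4 : ∑ j ∈ T' ∩ T, (q j (p j) - q j (p' j)) ≤ ∑ j ∈ T, (q j (p j) - q j (p' j)) :=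
      Finset.sum_le_sum_of_subset_of_nonneg Finset.inter_subset_right
        fun j hj _ => sub_nonneg.2 (hin j hj)
    linarith
  simp only [Finset.sum_sub_distrib] at h2
  simp only [qitUtil] at h1 ⊢
  linarith

/-- The effective price of an item in a demanded bundle is at most its marginal value. -/
lemma qitDemands.le_sub_erase [DecidableEq S] {v : Finset S → ℝ} {q : S → ℝ → ℝ} {p : S → ℝ}
    {T : Finset S} (h : qitDemands v q p T) {j : S} (hj : j ∈ T) :
    q j (p j) ≤ v T - v (T.erase j) := by
  have h1 := h (T.erase j)
  simp only [qitUtil, ← Finset.add_sum_erase T (fun j => q j (p j)) hj] at h1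
  linarith

/-- A state of the ascending auction with price increment `ε`: buyer `i` faces the price
`ε * a i j` for item `j` and currently demands `T i`; a buyer's price for `j` has only been
raised to `a i j` if `j` is filled by offers of at least `a i j - 1`. -/
structure IsAuctionState [Fintype B] [DecidableEq S] (cap : S → ℕ)
    (v : B → Finset S → ℝ) (q : B → S → ℝ → ℝ) (ε : ℝ) (a : B → S → ℕ) (T : B → Finset S) :
    Prop where
  demand : ∀ i, qitDemands (v i) (q i) (fun j => ε * a i j) (T i)
  support : ∀ i j, 0 < a i j → cap j ≤ #{k | j ∈ T k ∧ a i j ≤ a k j + 1}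

/-- If some item is over-demanded, the auction can raise one buyer's price for it. -/
lemma IsAuctionState.raise [Fintype B] [DecidableEq B] [DecidableEq S] {cap : S → ℕ}
    {v : B → Finset S → ℝ} {q : B → S → ℝ → ℝ} {ε : ℝ} {a : B → S → ℕ} {T : B → Finset S}
    (h : IsAuctionState cap v q ε a T) (hε : 0 ≤ ε)
    (hGS : ∀ i, QITUGrossSubstitutes (v i) (q i)) {j : S} (hj : cap j < #{k | j ∈ T k}) :
    ∃ i T', j ∈ T i ∧
      IsAuctionState cap v q ε (Function.update a i (Function.update (a i) j (a i j + 1))) T' := by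
  obtain ⟨i, hi, hmin⟩ := Finset.exists_min_image ({k | j ∈ T k} : Finset B) (fun k => a k j)
    (Finset.card_pos.1 (by omega))
  simp only [Finset.mem_filter, Finset.mem_univ, true_and] at hi hmin
  set a' := Function.update a i (Function.update (a i) j (a i j + 1)) with ha'
  have ha_le : ∀ k l, a k l ≤ a' k l := fun k l => by
    by_cases hk : k = i
    · subst hk
      by_cases hl : l = j
      · subst hl; simp [ha']
      · simp [ha', hl]
    · simp [ha', hk]
  have ha_ne : ∀ k l, ¬(k = i ∧ l = j) → a' k l = a k l := fun k l hkl => by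
    by_cases hk : k = i
    · subst hk
      have hl : l ≠ j := fun hl => hkl ⟨rfl, hl⟩
      simp [ha', hl]
    · simp [ha', hk]
  have ha_eq : a' i j = a i j + 1 := by simp [ha']
  obtain ⟨U, hU, hsub⟩ := hGS i (fun l => ε * a i l) (fun l => ε * a' i l)
    (fun l => by positivity)
    (fun l => mul_le_mul_of_nonneg_left (by exact_mod_cast ha_le i l) hε) (T i) (h.demand i)
  have hkeep : ∀ k l, ¬(k = i ∧ l = j) → l ∈ T k → l ∈ Function.update T i U k := by
    intro k l hkl hl
    by_cases hk : k = i
    · subst hk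
      simpa using hsub l hl (by simp only [ha_ne k l hkl])
    · simpa [hk] using hl
  refine ⟨i, Function.update T i U, hi, ⟨fun k => ?_, fun k l hkl => ?_⟩⟩
  · change qitDemands (v k) (q k) (fun l => ε * a' k l) _
    by_cases hk : k = i
    · subst hk; simpa only [Function.update_self] using hU
    · have : a' k = a k := by simp [ha', hk]
      simpa [hk, this] using h.demand k
  · change 0 < a' k l at hkl
    change cap l ≤ #{m | l ∈ Function.update T i U m ∧ a' k l ≤ a' m l + 1}
    by_cases hfull : l = j ∧ a' k l ≤ a i j + 1
    · obtain ⟨rfl, hle⟩ := hfull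
      have hsubset : ({m | l ∈ T m} : Finset B).erase i ⊆
          ({m | l ∈ Function.update T i U m ∧ a' k l ≤ a' m l + 1} : Finset B) := by
        intro m hm
        simp only [Finset.mem_erase, Finset.mem_filter, Finset.mem_univ, true_and] at hm ⊢
        refine ⟨hkeep m l (fun h => hm.1 h.1) hm.2, ?_⟩
        have h1 := hmin m hm.2
        have h2 := ha_le m l
        omega
      have h1 := Finset.card_le_card hsubset
      rw [Finset.card_erase_of_mem (by simpa using hi)] at h1
      omega
    · have hkl' : ¬(k = i ∧ l = j) := by
        rintro ⟨rfl, rfl⟩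
        exact hfull ⟨rfl, ha_eq.le⟩
      rw [ha_ne k l hkl'] at hkl hfull ⊢
      refine (h.support k l hkl).trans (Finset.card_le_card fun m hm => ?_)
      simp only [Finset.mem_filter, Finset.mem_univ, true_and] at hm ⊢
      have h2 := ha_le m l
      refine ⟨hkeep m l ?_ hm.1, by omega⟩
      rintro ⟨rfl, rfl⟩
      exact hfull ⟨rfl, hm.2⟩

/-- The auction terminates: if buyers never demand items priced at `N` increments or more, some
state with prices at most `N` has no over-demanded item. -/
lemma exists_isAuctionState_card_le [Fintype B] [Fintype S] [DecidableEq S]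
    {cap : S → ℕ}
    {v : B → Finset S → ℝ} {q : B → S → ℝ → ℝ} {ε : ℝ} (hε : 0 ≤ ε)
    (hGS : ∀ i, QITUGrossSubstitutes (v i) (q i)) (N : ℕ)
    (hN : ∀ a T, IsAuctionState cap v q ε a T → ∀ i, ∀ j ∈ T i, a i j < N) :
    ∃ a T, IsAuctionState cap v q ε a T ∧ (∀ i j, a i j ≤ N) ∧ ∀ j, #{k | j ∈ T k} ≤ cap j := by
  classical
  by_contra! hcon
  have key : ∀ n : ℕ, ∃ a T, IsAuctionState cap v q ε a T ∧ (∀ i j, a i j ≤ N) ∧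
      n ≤ ∑ i, ∑ j, a i j := by
    intro n
    induction n with
    | zero =>
      choose T hT using fun i => exists_qitDemands (v i) (q i) (fun _ => ε * ((0 : ℕ) : ℝ))
      exact ⟨fun _ _ => 0, T, ⟨hT, fun i j h => absurd h (lt_irrefl 0)⟩, by simp, by simp⟩
    | succ n ih =>
      obtain ⟨a, T, hst, hle, hsum⟩ := ih
      obtain ⟨j, hj⟩ := hcon a T hst hle
      obtain ⟨i, T', hi, hst'⟩ := hst.raise hε hGS hj
      refine ⟨_, T', hst', fun k l => ?_, ?_⟩
      · have h1 := hN a T hst i j hi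
        have h2 := hle k l
        simp only [Function.update_apply]
        split_ifs with hk
        · subst hk
          rw [Function.update_apply]
          split_ifs
          · exact h1
          · exact h2
        · exact h2
      · refine Nat.succ_le_of_lt (hsum.trans_lt ?_)
        have hle' : ∀ k l, a k l ≤
            Function.update a i (Function.update (a i) j (a i j + 1)) k l := fun k l => by
          by_cases hk : k = i
          · subst hk
            by_cases hl : l = j
            · subst hl; simp
            · simp [hl]
          · simp [hk]
        refine Finset.sum_lt_sum (fun k _ => Finset.sum_le_sum fun l _ => hle' k l)
          ⟨i, Finset.mem_univ i, ?_⟩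
        exact Finset.sum_lt_sum (fun l _ => hle' i l) ⟨j, Finset.mem_univ j, by simp⟩
  obtain ⟨a, T, -, hle, hsum⟩ := key ((∑ _i : B, ∑ _j : S, N) + 1)
  have : ∑ i, ∑ j, a i j ≤ ∑ _i : B, ∑ _j : S, N :=
    Finset.sum_le_sum fun i _ => Finset.sum_le_sum fun j _ => hle i j
  omega

/-- A state without over-demanded items yields uniform prices at which every buyer demands her
bundle, provided the items outside it cost one increment more. -/
lemma IsAuctionState.exists_prices [Fintype B] [DecidableEq S] {cap : S → ℕ}
    {v : B → Finset S → ℝ} {q : B → S → ℝ → ℝ} {ε : ℝ} {a : B → S → ℕ} {T : B → Finset S} {N : ℕ}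
    (h : IsAuctionState cap v q ε a T) (hε : 0 ≤ ε) (hle : ∀ i j, a i j ≤ N)
    (hcap : ∀ j, #{k | j ∈ T k} ≤ cap j) (hqmono : ∀ i j, StrictMonoOn (q i j) (Set.Ici (0 : ℝ))) :
    ∃ c : S → ℕ, (∀ j, c j ≤ N) ∧ (∀ j, #{k | j ∈ T k} < cap j → c j = 0) ∧
      ∀ i, qitDemands (v i) (q i) (fun j => ε * c j + if j ∈ T i then 0 else ε) (T i) := by
  have hmax : ∀ j, ∃ c : ℕ, (∀ i, a i j ≤ c + 1) ∧ (c = 0 ∨ ∃ i, a i j = c + 1) := fun j => by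
    refine ⟨Finset.univ.sup (fun i => a i j - 1), fun i => ?_, ?_⟩
    · have := Finset.le_sup (f := fun i => a i j - 1) (Finset.mem_univ i)
      omega
    · rcases isEmpty_or_nonempty B with hB | hB
      · left; simp
      · obtain ⟨i, -, hi⟩ := Finset.exists_mem_eq_sup Finset.univ Finset.univ_nonempty
          (fun i => a i j - 1)
        rw [hi]
        by_cases h0 : a i j - 1 = 0
        · exact Or.inl h0
        · exact Or.inr ⟨i, by omega⟩
  choose c hc hc' using hmax
  refine ⟨c, fun j => ?_, fun j hj => ?_, fun i => (h.demand i).of_le (fun j hj => ?_)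
    fun j hj => ?_⟩
  · rcases hc' j with h0 | ⟨i, hi⟩
    · omega
    · have := hle i j
      omega
  · rcases hc' j with h0 | ⟨i, hi⟩
    · exact h0
    · have h1 := h.support i j (by omega)
      have h2 : #{k | j ∈ T k ∧ a i j ≤ a k j + 1} ≤ #{k | j ∈ T k} :=
        Finset.card_le_card fun k hk => by simp_all
      omega
  · have hca : c j ≤ a i j := by
      rcases hc' j with h0 | ⟨k, hk⟩
      · omega
      · have h1 : ({m | j ∈ T m ∧ a k j ≤ a m j + 1} : Finset B) = ({m | j ∈ T m} : Finset B) :=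
          Finset.eq_of_subset_of_card_le (fun m hm => by simp_all)
            ((hcap j).trans (h.support k j (by omega)))
        have h2 : i ∈ ({m | j ∈ T m ∧ a k j ≤ a m j + 1} : Finset B) := by
          rw [h1]; simpa using hj
        simp only [Finset.mem_filter, Finset.mem_univ, true_and] at h2
        omega
    have hca' : (c j : ℝ) ≤ a i j := by exact_mod_cast hca
    refine (hqmono i j).monotoneOn ?_ ?_ ?_
    · simp only [hj, if_true, add_zero, Set.mem_Ici]; positivity
    · simp only [Set.mem_Ici]; positivity
    · simpa [hj] using mul_le_mul_of_nonneg_left hca' hε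
  · have hca : (a i j : ℝ) ≤ c j + 1 := by exact_mod_cast hc j i
    refine (hqmono i j).monotoneOn ?_ ?_ ?_
    · simp only [Set.mem_Ici]; positivity
    · simp only [hj, if_false, Set.mem_Ici]; positivity
    · have := mul_le_mul_of_nonneg_left hca hε
      simp only [hj, if_false]
      linarith

/-- In the QITU model with piecewise linear effective price functions and gross
substitutes valuations, a competitive equilibrium exists. -/
theorem competitiveEquilibrium_exists
    [Fintype B] [Fintype S] [DecidableEq B] [DecidableEq S]
    (cap : S → ℕ) (v : B → Finset S → ℝ) (q : B → S → ℝ → ℝ)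
    (hq0 : ∀ i j, q i j 0 = 0)
    (hqmono : ∀ i j, StrictMonoOn (q i j) (Set.Ici (0 : ℝ)))
    (hqcont : ∀ i j, Continuous (q i j))
    (hqnonneg : ∀ i j, ∀ x : ℝ, 0 ≤ x → 0 ≤ q i j x)
    (hqpl : ∀ i j, PiecewiseLinear (q i j))
    (hqreach : ∀ i j, ∃ P : ℝ, 0 ≤ P ∧ q i j P = v i {j})
    (hGS : ∀ i, QITUGrossSubstitutes (v i) (q i)) :
    ∃ (μ : Finset (B × S)) (p : S → ℝ),
      (∀ j, 0 ≤ p j) ∧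
      (∀ j, mmDeg μ j ≤ cap j) ∧
      (∀ j, mmDeg μ j < cap j → p j = 0) ∧
      (∀ i, qitDemands (v i) (q i) p (mmItems μ i)) := by
  obtain ⟨M, hM0, hM⟩ : ∃ M : ℝ, 0 ≤ M ∧ ∀ i j T T', v i T - v i T' < q i j M := by
    have h1 : ∀ i j, ∃ P : ℝ, 0 ≤ P ∧ ∀ T T', v i T - v i T' < q i j P := fun i j => by
      obtain ⟨K, hK⟩ := (Set.finite_range fun t : Finset S × Finset S => v i t.1 - v i t.2).bddAbove
      obtain ⟨P, hP0, hP⟩ := (hqpl i j).exists_lt (hqmono i j) K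
      exact ⟨P, hP0, fun T T' => (hK ⟨(T, T'), rfl⟩).trans_lt hP⟩
    choose P hP0 hP using h1
    refine ⟨∑ i, ∑ j, P i j, Finset.sum_nonneg fun i _ => Finset.sum_nonneg fun j _ => hP0 i j,
      fun i j T T' => (hP i j T T').trans_le ?_⟩
    have h2 : P i j ≤ ∑ i, ∑ j, P i j :=
      (Finset.single_le_sum (f := fun j => P i j) (fun j _ => hP0 i j) (Finset.mem_univ j)).trans
        (Finset.single_le_sum (f := fun i => ∑ j, P i j)
          (fun i _ => Finset.sum_nonneg fun j _ => hP0 i j) (Finset.mem_univ i))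
    exact (hqmono i j).monotoneOn (hP0 i j) ((hP0 i j).trans h2) h2
  have happrox : ∀ n : ℕ, ∃ (T : B → Finset S) (p : S → ℝ),
      (∀ j, p j ∈ Set.Icc 0 (M + 1)) ∧ (∀ j, #{k | j ∈ T k} ≤ cap j) ∧
      (∀ j, #{k | j ∈ T k} < cap j → p j = 0) ∧
      ∀ i, qitDemands (v i) (q i) (fun j => p j + if j ∈ T i then 0 else 1 / ((n : ℝ) + 1))
        (T i) := by
    intro n
    have hε : (0 : ℝ) < 1 / ((n : ℝ) + 1) := by positivity
    have hε1 : 1 / ((n : ℝ) + 1) ≤ 1 := by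
      rw [div_le_one (by positivity)]
      linarith [(Nat.cast_nonneg n : (0 : ℝ) ≤ n)]
    set ε : ℝ := 1 / ((n : ℝ) + 1)
    obtain ⟨a, T, hst, hle, hcap⟩ := exists_isAuctionState_card_le (cap := cap) hε.le hGS
      ⌈M / ε⌉₊ fun a T hst i j hj => by
        by_contra! hge
        have h1 : M ≤ ε * a i j := by
          rw [mul_comm, ← div_le_iff₀ hε]
          exact (Nat.le_ceil _).trans (by exact_mod_cast hge)
        have h2 := (hst.demand i).le_sub_erase hj
        have h3 := (hqmono i j).monotoneOn hM0 (hM0.trans h1) h1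
        have h4 := hM i j (T i) ((T i).erase j)
        linarith
    obtain ⟨c, hcN, hc0, hdem⟩ := hst.exists_prices hε.le hle hcap hqmono
    refine ⟨T, fun j => ε * c j, fun j => ⟨by positivity, ?_⟩, hcap,
      fun j hj => by simp [hc0 j hj], hdem⟩
    have h1 : (c j : ℝ) ≤ M / ε + 1 :=
      (Nat.cast_le.2 (hcN j)).trans (Nat.ceil_lt_add_one (by positivity)).le
    have h2 := mul_le_mul_of_nonneg_left h1 hε.le
    have h3 : ε * (M / ε + 1) = M + ε := by field_simp
    linarith
  choose T p hp hcap hfeas hdem using happrox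
  obtain ⟨U, hU⟩ : ∃ U, ∃ᶠ n in atTop, T n = U := by
    by_contra! hcon
    obtain ⟨n, hn⟩ := (eventually_all.2 hcon).exists
    exact hn (T n) rfl
  obtain ⟨φ, hφ, hTφ⟩ := extraction_of_frequently_atTop hU
  obtain ⟨r, hr, ψ, hψ, hlim⟩ := (isCompact_univ_pi fun _ : S => isCompact_Icc
    (a := (0 : ℝ)) (b := M + 1)).tendsto_subseq (x := fun n => p (φ n)) fun n j _ => hp (φ n) j
  have hlim' : ∀ j, Tendsto (fun n => p (φ (ψ n)) j) atTop (𝓝 (r j)) := tendsto_pi_nhds.1 hlim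
  have hstep : Tendsto (fun n => 1 / ((φ (ψ n) : ℝ) + 1)) atTop (𝓝 0) :=
    tendsto_one_div_add_atTop_nhds_zero_nat.comp (hφ.comp hψ).tendsto_atTop
  have hitems : ∀ i, mmItems ({e | e.2 ∈ U e.1} : Finset (B × S)) i = U i := fun i => by
    ext j
    simp [mmItems]
  have hdeg : ∀ j, mmDeg ({e | e.2 ∈ U e.1} : Finset (B × S)) j = #{k | j ∈ U k} := fun j => by
    refine Finset.card_bij (fun e _ => e.1) ?_ ?_ ?_
    · rintro ⟨k, l⟩ h
      simp only [Finset.mem_filter, Finset.mem_univ, true_and] at h ⊢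
      exact h.2 ▸ h.1
    · rintro ⟨k, l⟩ h ⟨k', l'⟩ h' hkk
      simp_all
    · intro k hk
      exact ⟨(k, j), by simpa using hk, rfl⟩
  refine ⟨({e | e.2 ∈ U e.1} : Finset (B × S)), r, fun j => (hr j trivial).1, fun j => ?_,
    fun j hj => ?_, fun i => ?_⟩
  · rw [hdeg, ← hTφ 0]
    exact hcap _ j
  · rw [hdeg] at hj
    refine tendsto_nhds_unique (hlim' j) ?_
    have : ∀ n, p (φ (ψ n)) j = 0 := fun n => hfeas _ j (by rw [hTφ]; exact hj)
    simp [this]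
  · rw [hitems]
    intro T'
    have hprice : ∀ j, Tendsto
        (fun n => p (φ (ψ n)) j + if j ∈ U i then 0 else 1 / ((φ (ψ n) : ℝ) + 1))
        atTop (𝓝 (r j)) := fun j => by
      by_cases hj : j ∈ U i
      · simpa [hj] using hlim' j
      · simpa [hj] using (hlim' j).add hstep
    have hutil : ∀ V, Tendsto (fun n => qitUtil (v i) (q i)
        (fun j => p (φ (ψ n)) j + if j ∈ U i then 0 else 1 / ((φ (ψ n) : ℝ) + 1)) V)
        atTop (𝓝 (qitUtil (v i) (q i) r V)) := fun V =>
      tendsto_const_nhds.sub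
        (tendsto_finsetSum V fun j _ => ((hqcont i j).tendsto (r j)).comp (hprice j))
    refine le_of_tendsto_of_tendsto' (hutil T') (hutil (U i)) fun n => ?_
    have h1 := hdem (φ (ψ n)) i
    rw [hTφ] at h1
    exact h1 T'
end

section
/- A valuation v : 2^S → ℝ on a finite set S satisfies gross substitutes if and only if v is submodular and for every T ⊆ S and all distinct items j1, j2, j3 ∉ T one has v({j1,j2}|T) + v({j3}|T) ≤ max( v({j1,j3}|T) + v({j2}|T), v({j2,j3}|T) + v({j1}|T) ), where v(A|T) = v(T ∪ A) − v(T). -/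
open Finset

variable {S : Type*}

/-- Quasilinear utility of bundle `T` at prices `p`. -/
def qUtil [DecidableEq S] (v : Finset S → ℝ) (p : S → ℝ) (T : Finset S) : ℝ :=
  v T - ∑ j ∈ T, p j

/-- `T` is a demanded set at prices `p`. -/
def Demands [DecidableEq S] (v : Finset S → ℝ) (p : S → ℝ) (T : Finset S) : Prop :=
  ∀ T' : Finset S, qUtil v p T' ≤ qUtil v p T

/-- Gross substitutes: if prices (weakly) increase, every demanded set keeps, inside some
new demanded set, all its items whose price did not change. -/
def GrossSubstitutes [DecidableEq S] (v : Finset S → ℝ) : Prop :=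
  ∀ p p' : S → ℝ, (∀ j, p j ≤ p' j) →
    ∀ T : Finset S, Demands v p T →
      ∃ T' : Finset S, Demands v p' T' ∧ ∀ j ∈ T, p j = p' j → j ∈ T'

/-- Submodularity of a set function. -/
def Submodular [DecidableEq S] (v : Finset S → ℝ) : Prop :=
  ∀ (T : Finset S) (j1 j2 : S), j1 ∉ T → j2 ∉ T → j1 ≠ j2 →
    v (insert j1 (insert j2 T)) + v T ≤ v (insert j1 T) + v (insert j2 T)

/-- Four-term local exchange property (tropical three-term Plücker relations). -/
def LocalExchange {α : Type*} [DecidableEq α] (ω : Finset α → ℝ) : Prop :=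
  ∀ (Z : Finset α) (a b c d : α), a ∉ Z → b ∉ Z → c ∉ Z → d ∉ Z →
    a ≠ b → a ≠ c → a ≠ d → b ≠ c → b ≠ d → c ≠ d →
    ω (insert a (insert b Z)) + ω (insert c (insert d Z)) ≤
        ω (insert a (insert c Z)) + ω (insert b (insert d Z)) ∨
      ω (insert a (insert b Z)) + ω (insert c (insert d Z)) ≤
        ω (insert a (insert d Z)) + ω (insert b (insert c Z))

/-- Three-item exchange in terms of `insert`. -/
def TripleExchange [DecidableEq S] (v : Finset S → ℝ) : Prop :=
  ∀ (T : Finset S) (a b c : S), a ∉ T → b ∉ T → c ∉ T → a ≠ b → a ≠ c → b ≠ c →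
    v (insert a (insert b T)) + v (insert c T) ≤
        v (insert a (insert c T)) + v (insert b T) ∨
      v (insert a (insert b T)) + v (insert c T) ≤
        v (insert b (insert c T)) + v (insert a T)

/-- The local exchange property implies the exchange property of valuated matroids between any
two sets of equal cardinality. -/
theorem LocalExchange.exchange {α : Type*} [DecidableEq α] {ω : Finset α → ℝ}
    (h : LocalExchange ω) {X Y : Finset α} (hcard : #X = #Y) {i : α}
    (hiX : i ∈ X) (hiY : i ∉ Y) :
    ∃ j ∈ Y \ X, ω X + ω Y ≤ ω (insert j (X.erase i)) + ω (insert i (Y.erase j)) := by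
  induction hn : #(X \ Y) using Nat.strong_induction_on generalizing Y with
  | _ n ih =>
  by_contra! hfail
  have hdiff : #(X \ Y) = #(Y \ X) := card_sdiff_comm hcard
  have hne : (Y \ X).Nonempty := by
    rw [← card_pos, ← hdiff, card_pos]
    exact ⟨i, by simp [hiX, hiY]⟩
  by_cases hsingle : X \ Y = {i}
  · rw [hsingle, card_singleton] at hdiff
    obtain ⟨j, hj⟩ := card_eq_one.mp hdiff.symm
    have hjm : j ∈ Y \ X := by simp [hj]
    have hX : ∀ x, (x ∈ X ∧ x ∉ Y) ↔ x = i := fun x => by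
      simpa using Finset.ext_iff.mp hsingle x
    have hY : ∀ x, (x ∈ Y ∧ x ∉ X) ↔ x = j := fun x => by
      simpa using Finset.ext_iff.mp hj x
    have e1 : insert j (X.erase i) = Y := by
      ext x; have := hX x; have := hY x; simp only [mem_insert, mem_erase]; grind
    have e2 : insert i (Y.erase j) = X := by
      ext x; have := hX x; have := hY x; simp only [mem_insert, mem_erase]; grind
    have := hfail j hjm
    rw [e1, e2] at this
    linarith
  · obtain ⟨b, hb, hbi⟩ : ∃ b ∈ X \ Y, b ≠ i := by
      by_contra! hall
      exact hsingle (Finset.ext fun x =>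
        ⟨fun hx => by simp [hall x hx], fun hx => by simp_all⟩)
    obtain ⟨hbX, hbY⟩ := mem_sdiff.mp hb
    obtain ⟨w, hw, hmax⟩ := exists_max_image (Y \ X)
      (fun w => ω (insert b (Y.erase w)) + ω (insert w (X.erase i))) hne
    obtain ⟨hwY, hwX⟩ := mem_sdiff.mp hw
    have hcard' : #X = #(insert b (Y.erase w)) := by
      rw [card_insert_of_notMem (by simp [hbY]), card_erase_add_one hwY, hcard]
    have hiY' : i ∉ insert b (Y.erase w) := by simp [hiY, hbi.symm]
    have hlt : #(X \ insert b (Y.erase w)) < n := by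
      rw [← hn]
      refine card_lt_card ⟨fun x hx => ?_, fun hsub => ?_⟩
      · simp only [mem_sdiff, mem_insert, mem_erase] at hx ⊢
        grind
      · simpa using hsub hb
    obtain ⟨j, hj, hle⟩ := ih _ hlt hcard' hiY' rfl
    simp only [mem_sdiff, mem_insert, mem_erase] at hj
    have hjb : j ≠ b := fun hjb => hj.2 (hjb ▸ hbX)
    obtain ⟨⟨hjw, hjY⟩, hjX⟩ : (j ≠ w ∧ j ∈ Y) ∧ j ∉ X := ⟨hj.1.resolve_left hjb, hj.2⟩
    have hjm : j ∈ Y \ X := by simp [hjY, hjX]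
    have hloc := h ((Y.erase w).erase j) i b w j (by simp [hiY]) (by simp [hbY]) (by simp)
      (by simp) hbi.symm (by grind) (by grind) (by grind) (by grind) hjw.symm
    have e1 : insert w (insert j ((Y.erase w).erase j)) = Y := by
      rw [insert_erase (by simp [hjw, hjY]), insert_erase hwY]
    have e2 : insert j ((Y.erase w).erase j) = Y.erase w :=
      insert_erase (by simp [hjw, hjY])
    have e3 : insert w ((Y.erase w).erase j) = Y.erase j := by
      rw [erase_right_comm, insert_erase (by simp [hjw.symm, hwY])]
    have e4 : insert i (insert b ((Y.erase w).erase j)) =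
        insert i ((insert b (Y.erase w)).erase j) := by
      rw [erase_insert_of_ne hjb.symm]
    rw [e1, e2, e3, e4] at hloc
    have h1 := hfail j hjm
    have h2 := hfail w hw
    have h3 := hmax j hjm
    rcases hloc with hloc | hloc <;> linarith

/-- The three-item exchange property implies its four-item analogue. -/
theorem TripleExchange.localExchange [DecidableEq S] {v : Finset S → ℝ}
    (h : TripleExchange v) : LocalExchange v := by
  intro Z a b c d ha hb hc hd hab hac had hbc hbd hcd
  have h1 := h Z a b c ha hb hc hab hac hbc
  have h2 := h Z a b d ha hb hd hab had hbd
  have h3 := h Z c d a hc hd ha hcd hac.symm had.symm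
  have h4 := h Z c d b hc hd hb hcd hbc.symm hbd.symm
  rw [insert_comm c a, insert_comm d a] at h3
  rw [insert_comm c b, insert_comm d b] at h4
  by_contra! hcon
  obtain ⟨hcon1, hcon2⟩ := hcon
  rcases h1 with h1 | h1 <;> rcases h2 with h2 | h2 <;> rcases h3 with h3 | h3 <;>
    rcases h4 with h4 | h4 <;> linarith

/-- Padding with worthless items turns submodularity and three-item exchange into local
exchange. -/
theorem Submodular.localExchange_toLeft [DecidableEq S] {v : Finset S → ℝ}
    (hsub : Submodular v) (h : TripleExchange v) :
    LocalExchange fun W : Finset (S ⊕ S) => v W.toLeft := by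
  intro Z a b c d ha hb hc hd hab hac had hbc hbd hcd
  have h4 := h.localExchange Z.toLeft
  have h3 := h Z.toLeft
  have h2 := hsub Z.toLeft
  rcases a with a | a <;> rcases b with b | b <;> rcases c with c | c <;> rcases d with d | d <;>
    simp only [toLeft_insert_inl, toLeft_insert_inr, ne_eq, Sum.inl.injEq, reduceCtorEq,
      not_false_eq_true, ← mem_toLeft] at * <;>
    grind [Finset.insert_comm]

/-- The `M♮` exchange property. -/
theorem Submodular.exchange [Fintype S] [DecidableEq S] {v : Finset S → ℝ}
    (hsub : Submodular v) (h : TripleExchange v) {X Y : Finset S} {i : S}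
    (hiX : i ∈ X) (hiY : i ∉ Y) :
    v X + v Y ≤ v (X.erase i) + v (insert i Y) ∨
      ∃ j ∈ Y \ X, v X + v Y ≤ v (insert j (X.erase i)) + v (insert i (Y.erase j)) := by
  have hpad : ∀ W : Finset S, #(W.disjSum Wᶜ) = Fintype.card S := fun W => by
    rw [card_disjSum, card_add_card_compl]
  have herase : ∀ (W : Finset (S ⊕ S)) (x : S),
      (W.erase (Sum.inl x)).toLeft = W.toLeft.erase x := fun W x => by
    ext y; simp
  have herase' : ∀ (W : Finset (S ⊕ S)) (x : S),
      (W.erase (Sum.inr x)).toLeft = W.toLeft := fun W x => by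
    ext y; simp
  obtain ⟨j, hj, hle⟩ := (hsub.localExchange_toLeft h).exchange
    (X := X.disjSum Xᶜ) (Y := Y.disjSum Yᶜ) (i := Sum.inl i)
    ((hpad X).trans (hpad Y).symm) (by simpa using hiX) (by simpa using hiY)
  rcases j with j | j
  · right
    refine ⟨j, by simpa using hj, ?_⟩
    simpa [herase, toLeft_disjSum] using hle
  · left
    simpa [herase, herase', toLeft_disjSum] using hle

theorem exists_demands [Fintype S] [DecidableEq S] (v : Finset S → ℝ) (p : S → ℝ) :
    ∃ T, Demands v p T :=
  Finite.exists_max (qUtil v p)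

theorem Submodular.grossSubstitutes [Fintype S] [DecidableEq S] {v : Finset S → ℝ}
    (hsub : Submodular v) (h : TripleExchange v) : GrossSubstitutes v := by
  classical
  intro p p' hp T hT
  set A := T.filter fun j => p j = p' j with hA
  obtain ⟨X, hX, hmax⟩ := exists_max_image (univ.filter fun X => Demands v p' X)
    (fun X => #(A ∩ X)) (by
      obtain ⟨X, hX⟩ := exists_demands v p'
      exact ⟨X, by simpa using hX⟩)
  simp only [mem_filter, mem_univ, true_and] at hX hmax
  refine ⟨X, hX, ?_⟩
  by_contra! hcon
  obtain ⟨i, hiT, hpi, hiX⟩ := hcon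
  have hiA : i ∈ A := by simp [hA, hiT, hpi]
  -- a demanded bundle agreeing with `A` on `i` and on `A ∩ X` contradicts maximality
  have key : ∀ X', i ∈ X' → A ∩ X ⊆ X' → ¬ qUtil v p' X ≤ qUtil v p' X' := by
    intro X' hi hsubset hle
    refine (hmax X' fun W => (hX W).trans hle).not_gt (card_lt_card ⟨fun x hx => ?_, fun hs => ?_⟩)
    · exact mem_inter.mpr ⟨(mem_inter.mp hx).1, hsubset hx⟩
    · exact hiX (mem_inter.mp (hs (mem_inter.mpr ⟨hiA, hi⟩))).2
  rcases hsub.exchange h hiT hiX with hle | ⟨j, hj, hle⟩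
  · refine key (insert i X) (by simp) (fun x hx => by simp_all) ?_
    have := hT (T.erase i)
    simp only [qUtil, sum_insert hiX, sum_erase_eq_sub hiT] at *
    linarith
  · obtain ⟨hjX, hjT⟩ := mem_sdiff.mp hj
    refine key (insert i (X.erase j)) (by simp) (fun x hx => ?_) ?_
    · simp only [hA, mem_inter, mem_filter, mem_insert, mem_erase] at hx ⊢
      grind
    · have := hT (insert j (T.erase i))
      have := hp j
      simp only [qUtil, sum_insert (show i ∉ X.erase j by simp [hiX]),
        sum_insert (show j ∉ T.erase i by simp [hjT]),
        sum_erase_eq_sub hiT, sum_erase_eq_sub hjX] at *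
      linarith

/-- Prohibitive prices force every demanded bundle to contain `T` and to lie in `T ∪ J`. -/
theorem Demands.subset_and_subset [DecidableEq S] {v : Finset S → ℝ} {p : S → ℝ}
    {B : ℝ} (hB : ∀ X Y, v X - v Y < B) {T J W : Finset S} (hT : ∀ j ∈ T, p j ≤ -B)
    (hJ : ∀ j, j ∉ T ∪ J → B ≤ p j) (hW : Demands v p W) : T ⊆ W ∧ W ⊆ T ∪ J := by
  constructor
  · intro j hj
    by_contra hjW
    have h1 := hW (insert j W)
    have h2 := hB W (insert j W)
    have h3 := hT j hj
    simp only [qUtil, sum_insert hjW] at h1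
    linarith
  · intro j hj
    by_contra hjT
    have h1 := hW (W.erase j)
    have h2 := hB W (W.erase j)
    have h3 := hJ j hjT
    simp only [qUtil, sum_erase_eq_sub hj] at h1
    linarith

/-- Gross substitutes passes to the minor on `J` obtained by contracting `T`. -/
theorem GrossSubstitutes.minor [Fintype S] [DecidableEq S] {v : Finset S → ℝ}
    (h : GrossSubstitutes v) {T J : Finset S} (hTJ : Disjoint T J) {q q' : S → ℝ}
    (hq : ∀ j, q j ≤ q' j) {X : Finset S} (hXJ : X ⊆ J)
    (hX : ∀ Y ⊆ J, qUtil (fun Y => v (T ∪ Y)) q Y ≤ qUtil (fun Y => v (T ∪ Y)) q X) :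
    ∃ X' ⊆ J,
      (∀ Y ⊆ J, qUtil (fun Y => v (T ∪ Y)) q' Y ≤ qUtil (fun Y => v (T ∪ Y)) q' X') ∧
      ∀ j ∈ X, q j = q' j → j ∈ X' := by
  obtain ⟨B, hB⟩ : ∃ B, ∀ X Y, v X - v Y < B := by
    obtain ⟨X, hX⟩ := Finite.exists_max v
    obtain ⟨Y, hY⟩ := Finite.exists_min v
    exact ⟨v X - v Y + 1, fun X' Y' => by linarith [hX X', hY Y']⟩
  let extend (q : S → ℝ) (j : S) : ℝ := if j ∈ T then -B else if j ∈ J then q j else B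
  have extend_eq : ∀ q : S → ℝ, ∀ j ∈ J, extend q j = q j := fun q j hj => by
    simp [extend, hj, disjoint_right.mp hTJ hj]
  have hutil : ∀ (q : S → ℝ), ∀ Y ⊆ J, qUtil v (extend q) (T ∪ Y) =
      qUtil (fun Y => v (T ∪ Y)) q Y - ∑ j ∈ T, extend q j := by
    intro q Y hY
    simp only [qUtil]
    rw [sum_union (hTJ.mono_right hY), sum_congr rfl fun j hj => extend_eq q j (hY hj)]
    ring
  have hmem : ∀ q W, Demands v (extend q) W → ∃ Y ⊆ J, W = T ∪ Y := by
    intro q W hW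
    obtain ⟨h1, h2⟩ := hW.subset_and_subset hB (T := T) (J := J)
      (fun j hj => by simp [extend, hj]) (fun j hj => by simp_all [extend])
    exact ⟨W \ T, sdiff_le_iff.mpr h2, by rw [union_sdiff_of_subset h1]⟩
  have hdem : Demands v (extend q) (T ∪ X) := by
    obtain ⟨W, hW⟩ := exists_demands v (extend q)
    obtain ⟨Y, hY, rfl⟩ := hmem q W hW
    refine fun W' => (hW W').trans ?_
    rw [hutil q Y hY, hutil q X hXJ]
    linarith [hX Y hY]
  obtain ⟨W', hW', hkeep⟩ := h (extend q) (extend q')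
    (fun j => by simp only [extend]; split_ifs <;> simp [hq]) _ hdem
  obtain ⟨X', hX', rfl⟩ := hmem q' W' hW'
  refine ⟨X', hX', fun Y hY => ?_, fun j hj hjq => ?_⟩
  · have := hW' (T ∪ Y)
    rw [hutil q' Y hY, hutil q' X' hX'] at this
    linarith
  · have hjJ := hXJ hj
    have := hkeep j (mem_union_right _ hj) (by rw [extend_eq q j hjJ, extend_eq q' j hjJ, hjq])
    exact (mem_union.mp this).resolve_left (disjoint_right.mp hTJ hjJ)

theorem GrossSubstitutes.submodular [Fintype S] [DecidableEq S] {v : Finset S → ℝ}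
    (h : GrossSubstitutes v) : Submodular v := by
  intro T a b ha hb hab
  by_contra! hlt
  let ε := (v (insert a (insert b T)) + v T - v (insert a T) - v (insert b T)) / 2
  let q : S → ℝ := fun j => v (insert j T) - v T + ε
  let q' : S → ℝ := fun j => if j = a then q a + 1 else q j
  have hε : 2 * ε = v (insert a (insert b T)) + v T - v (insert a T) - v (insert b T) := by
    simp only [ε]; ring
  have hqa : q a = v (insert a T) - v T + ε := rfl
  have hqb : q b = v (insert b T) - v T + ε := rfl
  have hqa' : q' a = q a + 1 := by simp [q']
  have hqb' : q' b = q b := by simp [q', hab.symm]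
  have hsets : ∀ Y ⊆ ({a, b} : Finset S), Y = ∅ ∨ Y = {a} ∨ Y = {b} ∨ Y = {a, b} := by
    intro Y hY
    rw [← mem_powerset] at hY
    simp [powerset_insert] at hY
    grind
  have hutil0 : ∀ r, qUtil (fun Y => v (T ∪ Y)) r ∅ = v T := fun r => by simp [qUtil]
  have hutil1 : ∀ r x, qUtil (fun Y => v (T ∪ Y)) r {x} = v (insert x T) - r x := fun r x => by
    simp [qUtil, union_comm T, singleton_union]
  have hutil2 : ∀ r, qUtil (fun Y => v (T ∪ Y)) r {a, b} =
      v (insert a (insert b T)) - (r a + r b) := fun r => by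
    simp [qUtil, union_comm T, insert_union, singleton_union, sum_pair hab]
  obtain ⟨X, hXJ, hX, hkeep⟩ := h.minor (T := T) (J := {a, b}) (q := q) (q' := q')
    (X := {a, b}) (by simp [ha, hb])
    (fun j => by simp only [q']; split_ifs with hj <;> simp [hj]) subset_rfl
    (fun Y hY => by
      rcases hsets Y hY with rfl | rfl | rfl | rfl <;> simp only [hutil0, hutil1, hutil2] <;>
        linarith)
  have hbX := hkeep b (by simp) hqb'.symm
  have hX0 := hX ∅ (by simp)
  rcases hsets X hXJ with rfl | rfl | rfl | rfl
  · simp at hbX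
  · exact hab.symm (by simpa using hbX)
  · rw [hutil0, hutil1] at hX0
    linarith
  · rw [hutil0, hutil2] at hX0
    linarith

theorem GrossSubstitutes.tripleExchange [Fintype S] [DecidableEq S] {v : Finset S → ℝ}
    (h : GrossSubstitutes v) : TripleExchange v := by
  intro T a b c ha hb hc hab hac hbc
  by_contra! hcon
  obtain ⟨hlt1, hlt2⟩ := hcon
  have hsub := h.submodular
  let qa := (v (insert a (insert b T)) - v (insert c T) +
    v (insert a (insert c T)) - v (insert b T)) / 2
  let qb := (v (insert a (insert b T)) - v (insert c T) +
    v (insert b (insert c T)) - v (insert a T)) / 2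
  let qc := (v (insert a (insert c T)) - v (insert b T) +
    v (insert b (insert c T)) - v (insert a T)) / 2
  let q : S → ℝ := fun j => if j = a then qa else if j = b then qb else qc
  let q' : S → ℝ := fun j => if j = a then q a + 1 else q j
  have hqa : q a = qa := by simp [q]
  have hqb : q b = qb := by simp [q, hab.symm]
  have hqc : q c = qc := by simp [q, hac.symm, hbc.symm]
  have hqa' : q' a = q a + 1 := by simp [q']
  have hqb' : q' b = q b := by simp [q', hab.symm]
  have hqc' : q' c = q c := by simp [q', hac.symm]
  have hsets : ∀ Y ⊆ ({a, b, c} : Finset S), Y = ∅ ∨ Y = {a} ∨ Y = {b} ∨ Y = {c} ∨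
      Y = {a, b} ∨ Y = {a, c} ∨ Y = {b, c} ∨ Y = {a, b, c} := by
    intro Y hY
    rw [← mem_powerset] at hY
    simp [powerset_insert] at hY
    grind [Finset.insert_comm]
  have hutil0 : ∀ r, qUtil (fun Y => v (T ∪ Y)) r ∅ = v T := fun r => by simp [qUtil]
  have hutil1 : ∀ r x, qUtil (fun Y => v (T ∪ Y)) r {x} = v (insert x T) - r x := fun r x => by
    simp [qUtil, union_comm T, singleton_union]
  have hutil2 : ∀ r x y, x ≠ y → qUtil (fun Y => v (T ∪ Y)) r {x, y} =
      v (insert x (insert y T)) - (r x + r y) := fun r x y hxy => by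
    simp [qUtil, union_comm T, insert_union, singleton_union, sum_pair hxy]
  have hutil3 : ∀ r, qUtil (fun Y => v (T ∪ Y)) r {a, b, c} =
      v (insert a (insert b (insert c T))) - (r a + r b + r c) := fun r => by
    simp [qUtil, union_comm T, insert_union, singleton_union, hab, hac, hbc, add_assoc]
  have s1 := hsub T a b ha hb hab
  have s2 := hsub (insert c T) a b (by simp [ha, hac]) (by simp [hb, hbc]) hab
  obtain ⟨X, hXJ, hX, hkeep⟩ := h.minor (T := T) (J := {a, b, c}) (q := q) (q' := q')
    (X := {a, b}) (by simp [ha, hb, hc])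
    (fun j => by simp only [q']; split_ifs with hj <;> simp [hj])
    (by intro x; simp; tauto)
    (fun Y hY => by
      rcases hsets Y hY with rfl | rfl | rfl | rfl | rfl | rfl | rfl | rfl <;>
        simp only [hutil0, hutil1, hutil2, hutil3, hab, hac, hbc, ne_eq, not_false_eq_true,
          hqa, hqb, hqc, qa, qb, qc] <;>
        linarith)
  have hbX := hkeep b (by simp) hqb'.symm
  have hXc := hX {c} (by simp)
  rcases hsets X hXJ with rfl | rfl | rfl | rfl | rfl | rfl | rfl | rfl <;>
    first
    | (simp [hab.symm, hbc] at hbX; done)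
    | simp only [hutil1, hutil2, hutil3, hab, hbc, ne_eq, not_false_eq_true,
        hqa', hqb', hqc', hqa, hqb, hqc, qa, qb, qc] at hXc
      linarith

/-- A valuation satisfies gross substitutes iff it is submodular and satisfies the
three-item exchange condition (ISO). -/
theorem grossSubstitutes_iff_submodular_and_exchange
    [Fintype S] [DecidableEq S] (v : Finset S → ℝ) :
    GrossSubstitutes v ↔
      Submodular v ∧
        ∀ (T : Finset S) (j1 j2 j3 : S), j1 ∉ T → j2 ∉ T → j3 ∉ T →
          j1 ≠ j2 → j1 ≠ j3 → j2 ≠ j3 →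
          (v (T ∪ {j1, j2}) - v T) + (v (T ∪ {j3}) - v T) ≤
            max ((v (T ∪ {j1, j3}) - v T) + (v (T ∪ {j2}) - v T))
              ((v (T ∪ {j2, j3}) - v T) + (v (T ∪ {j1}) - v T)) := by
  have hiff : TripleExchange v ↔
      ∀ (T : Finset S) (j1 j2 j3 : S), j1 ∉ T → j2 ∉ T → j3 ∉ T →
        j1 ≠ j2 → j1 ≠ j3 → j2 ≠ j3 →
        (v (T ∪ {j1, j2}) - v T) + (v (T ∪ {j3}) - v T) ≤
          max ((v (T ∪ {j1, j3}) - v T) + (v (T ∪ {j2}) - v T))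
            ((v (T ∪ {j2, j3}) - v T) + (v (T ∪ {j1}) - v T)) := by
    simp only [TripleExchange, le_max_iff, union_comm _ (insert _ _), union_comm _ {_},
      insert_union, singleton_union, sub_add_sub_comm, sub_le_sub_iff_right]
  rw [← hiff]
  exact ⟨fun h => ⟨h.submodular, h.tripleExchange⟩, fun h => h.1.grossSubstitutes h.2⟩
end

section
/- Let v : 2^S → ℝ satisfy gross substitutes, let T ⊆ S, and let p ∈ ℝ^S. Then the function w : 2^{S∖T} → ℝ defined by w(A) = v(A ∪ T) − v(T) − Σ_{j∈A} p_j satisfies gross substitutes on the ground set S ∖ T. -/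
open Finset

variable {S : Type*}

/-- Extends prices on `S ∖ T` to `S`: the initial prices `p` are added outside `T`, and every
item of `T` is subsidised by `M`. -/
def extendPrices [DecidableEq S] (T : Finset S) (p : S → ℝ) (M : ℝ)
    (q : {j : S // j ∉ T} → ℝ) (j : S) : ℝ :=
  if h : j ∉ T then p j + q ⟨j, h⟩ else -M

theorem Finset.image_val_subtype_notMem_union [DecidableEq S] (T B : Finset S) :
    (B.subtype (fun j => j ∉ T)).image Subtype.val ∪ T = B ∪ T := by
  ext j
  simp only [mem_union, mem_image, mem_subtype, Subtype.exists, exists_and_left, exists_prop,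
    exists_eq_right_right]
  tauto

theorem exists_subsidy [Fintype S] [DecidableEq S] (v : Finset S → ℝ) (T : Finset S) :
    ∃ M : ℝ, 0 ≤ M ∧ ∀ B, v B ≤ v (B ∪ T) + M := by
  refine ⟨∑ B, |v B - v (B ∪ T)|, sum_nonneg fun B _ => abs_nonneg _, fun B => ?_⟩
  have h := single_le_sum (f := fun B => |v B - v (B ∪ T)|) (fun B _ => abs_nonneg _) (mem_univ B)
  have h' := le_abs_self (v B - v (B ∪ T))
  linarith

theorem qUtil_le_qUtil_union [DecidableEq S] {v : Finset S → ℝ} {T : Finset S} {M : ℝ}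
    (hM₀ : 0 ≤ M) (hM : ∀ B, v B ≤ v (B ∪ T) + M) (p : S → ℝ)
    (q : {j : S // j ∉ T} → ℝ) (B : Finset S) :
    qUtil v (extendPrices T p M q) B ≤ qUtil v (extendPrices T p M q) (B ∪ T) := by
  have hsum : ∑ j ∈ T \ B, extendPrices T p M q j = (T \ B).card * -M := by
    rw [← nsmul_eq_mul, ← sum_const]
    refine sum_congr rfl fun j hj => ?_
    simp [extendPrices, (mem_sdiff.mp hj).1]
  have hunion : ∑ j ∈ B ∪ T, extendPrices T p M q j
      = ∑ j ∈ B, extendPrices T p M q j + (T \ B).card * -M := by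
    rw [← hsum, ← sum_union disjoint_sdiff, union_sdiff_self_eq_union]
  unfold qUtil
  rw [hunion]
  rcases (T \ B).eq_empty_or_nonempty with h | h
  · rw [union_eq_left.mpr (sdiff_eq_empty_iff_subset.mp h), h]
    simp
  · have hcard : (1 : ℝ) ≤ (T \ B).card := by exact_mod_cast h.card_pos
    nlinarith [hM B]

theorem qUtil_extendPrices [DecidableEq S] (v : Finset S → ℝ) (T : Finset S) (p : S → ℝ) (M : ℝ)
    (q : {j : S // j ∉ T} → ℝ) (A : Finset {j : S // j ∉ T}) :
    qUtil v (extendPrices T p M q) (A.image Subtype.val ∪ T)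
      = qUtil (fun A : Finset {j : S // j ∉ T} =>
          v ((A.image Subtype.val) ∪ T) - v T - ∑ j ∈ A, p j.val) q A + (v T + T.card * M) := by
  have hdisj : Disjoint (A.image Subtype.val) T := by
    rw [disjoint_left]
    intro j hj
    obtain ⟨a, -, rfl⟩ := mem_image.mp hj
    exact a.2
  have hT : ∑ j ∈ T, extendPrices T p M q j = T.card * -M := by
    rw [← nsmul_eq_mul, ← sum_const]
    refine sum_congr rfl fun j hj => ?_
    simp [extendPrices, hj]
  have hA : ∑ j ∈ A.image Subtype.val, extendPrices T p M q j
      = ∑ j ∈ A, p j.val + ∑ j ∈ A, q j := by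
    rw [sum_image Subtype.val_injective.injOn, ← sum_add_distrib]
    refine sum_congr rfl fun j _ => ?_
    simp [extendPrices, j.2]
  simp only [qUtil]
  rw [sum_union hdisj, hT, hA]
  ring

theorem demands_extendPrices_iff [DecidableEq S] {v : Finset S → ℝ} {T : Finset S} {M : ℝ}
    (hM₀ : 0 ≤ M) (hM : ∀ B, v B ≤ v (B ∪ T) + M) (p : S → ℝ)
    (q : {j : S // j ∉ T} → ℝ) (A : Finset {j : S // j ∉ T}) :
    Demands v (extendPrices T p M q) (A.image Subtype.val ∪ T) ↔
      Demands (fun A : Finset {j : S // j ∉ T} =>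
        v ((A.image Subtype.val) ∪ T) - v T - ∑ j ∈ A, p j.val) q A := by
  refine ⟨fun h B => ?_, fun h B => (qUtil_le_qUtil_union hM₀ hM p q B).trans ?_⟩
  · have := h (B.image Subtype.val ∪ T)
    rwa [qUtil_extendPrices, qUtil_extendPrices, add_le_add_iff_right] at this
  · rw [← image_val_subtype_notMem_union, qUtil_extendPrices, qUtil_extendPrices,
      add_le_add_iff_right]
    exact h _

/-- Gross substitutes is preserved by fixing an initial endowment `T` and initial
prices `p`: the marginal utility function on the ground set `S ∖ T` again satisfies
gross substitutes. -/
theorem endowment_prices_preserve_grossSubstitutes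
    [Fintype S] [DecidableEq S] (v : Finset S → ℝ) (hv : GrossSubstitutes v)
    (T : Finset S) (p : S → ℝ) :
    GrossSubstitutes
      (fun A : Finset {j : S // j ∉ T} =>
        v ((A.image Subtype.val) ∪ T) - v T - ∑ j ∈ A, p j.val) := by
  intro q q' hq A hA
  obtain ⟨M, hM₀, hM⟩ := exists_subsidy v T
  have hle : ∀ j, extendPrices T p M q j ≤ extendPrices T p M q' j := by
    intro j
    unfold extendPrices
    split_ifs
    · exact le_rfl
    · exact add_le_add_right (hq _) _
  obtain ⟨B, hB, hAB⟩ := hv _ _ hle _ ((demands_extendPrices_iff hM₀ hM p q A).mpr hA)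
  refine ⟨B.subtype (fun j => j ∉ T), ?_, fun j hj hqj => ?_⟩
  · rw [← demands_extendPrices_iff hM₀ hM, image_val_subtype_notMem_union]
    exact fun C => (hB C).trans (qUtil_le_qUtil_union hM₀ hM p q' B)
  · rw [mem_subtype]
    refine hAB j (mem_union_left _ (mem_image_of_mem _ hj)) ?_
    simp [extendPrices, j.2, hqj]
end

section
/- Let v_1, …, v_z : 2^S → ℝ each satisfy gross substitutes. Then the convolution v* : 2^S → ℝ defined by v*(T) = max over all partitions (π_1,…,π_z) of T into z (possibly empty) disjoint parts of Σ_{x=1}^{z} v_x(π_x) also satisfies gross substitutes. -/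
open Finset

variable {S : Type*}

/-- `π` is a partition of `T` into `z` (possibly empty) disjoint parts. -/
def IsPartitionInto [DecidableEq S] {z : ℕ} (π : Fin z → Finset S) (T : Finset S) : Prop :=
  (∀ x y : Fin z, x ≠ y → Disjoint (π x) (π y)) ∧ Finset.univ.biUnion π = T

/-- The convolution of the valuations `vs 1, …, vs z`. -/
noncomputable def convolution [DecidableEq S] {z : ℕ} (vs : Fin z → Finset S → ℝ)
    (T : Finset S) : ℝ :=
  sSup {r : ℝ | ∃ π : Fin z → Finset S, IsPartitionInto π T ∧ r = ∑ x, vs x (π x)}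

section Convolution

variable [DecidableEq S] {z : ℕ}

theorem le_convolution [Fintype S] (vs : Fin z → Finset S → ℝ) {π : Fin z → Finset S}
    {T : Finset S} (h : IsPartitionInto π T) : ∑ x, vs x (π x) ≤ convolution vs T := by
  refine le_csSup (Set.Finite.bddAbove ?_) ⟨π, h, rfl⟩
  refine (Set.finite_range fun π : Fin z → Finset S => ∑ x, vs x (π x)).subset ?_
  rintro r ⟨π, -, rfl⟩
  exact ⟨π, rfl⟩

theorem exists_isPartitionInto_convolution_eq [Fintype S] [NeZero z]
    (vs : Fin z → Finset S → ℝ) (T : Finset S) :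
    ∃ π, IsPartitionInto π T ∧ convolution vs T = ∑ x, vs x (π x) := by
  refine Set.Nonempty.csSup_mem (s := {r : ℝ | ∃ π : Fin z → Finset S,
    IsPartitionInto π T ∧ r = ∑ x, vs x (π x)}) ?_ ?_
  · refine ⟨_, fun x => if x = 0 then T else ∅, ⟨fun x y hxy => ?_, ?_⟩, rfl⟩
    · by_cases hx : x = 0
      · simp [show y ≠ 0 from fun hy => hxy (hx.trans hy.symm)]
      · simp [hx]
    · ext j
      simp only [Finset.mem_biUnion, Finset.mem_univ, true_and]
      exact ⟨fun ⟨x, hx⟩ => by by_cases h : x = 0 <;> simp_all, fun hj => ⟨0, by simpa using hj⟩⟩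
  · refine (Set.finite_range fun π : Fin z → Finset S => ∑ x, vs x (π x)).subset ?_
    rintro r ⟨π, -, rfl⟩
    exact ⟨π, rfl⟩

theorem sum_qUtil_add_sum_sub (vs : Fin z → Finset S → ℝ) (p q : S → ℝ)
    {π : Fin z → Finset S} {T : Finset S} (h : IsPartitionInto π T) :
    ∑ x, qUtil (vs x) q (π x) + ∑ j ∈ T, (q j - p j) = ∑ x, vs x (π x) - ∑ j ∈ T, p j := by
  have hT : ∑ j ∈ T, q j = ∑ x, ∑ j ∈ π x, q j := by
    rw [← h.2, Finset.sum_biUnion fun x _ y _ hxy => h.1 x y hxy]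
  simp only [qUtil, Finset.sum_sub_distrib, hT]
  ring

end Convolution

theorem Demands.price_le [DecidableEq S] {v : Finset S → ℝ} {p : S → ℝ} {T : Finset S}
    (h : Demands v p T) {j : S} (hj : j ∈ T) : p j ≤ v T - v (T.erase j) := by
  have h1 := h (T.erase j)
  have h2 := Finset.add_sum_erase T p hj
  simp only [qUtil] at h1
  linarith

theorem grossSubstitutes_const [Fintype S] [DecidableEq S] (c : ℝ) :
    GrossSubstitutes (fun _ : Finset S => c) := by
  intro p p' _ T hT
  refine ⟨Finset.univ.filter fun j => p' j ≤ 0, fun T' => ?_, fun j hj hpj => ?_⟩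
  · have h1 : ∑ j ∈ Finset.univ.filter (fun j => p' j ≤ 0), p' j ≤ ∑ j ∈ T', p' j := by
      rw [← Finset.sum_filter_add_sum_filter_not T' fun j => p' j ≤ 0]
      have h2 : 0 ≤ ∑ j ∈ T' with ¬ p' j ≤ 0, p' j :=
        Finset.sum_nonneg fun j hj => (not_le.1 (Finset.mem_filter.1 hj).2).le
      have h3 := Finset.sum_le_sum_of_subset_of_nonneg (f := fun j => - p' j)
        (Finset.filter_subset_filter (fun j => p' j ≤ 0) (Finset.subset_univ T'))
        fun j hj _ => neg_nonneg.2 (Finset.mem_filter.1 hj).2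
      simp only [Finset.sum_neg_distrib] at h3
      linarith
    simp only [qUtil]
    linarith
  · have := hT.price_le hj
    simp only [sub_self] at this
    simp [← hpj, this]

theorem exists_abs_le [Fintype S] {z : ℕ} (vs : Fin z → Finset S → ℝ) :
    ∃ M, ∀ x T, |vs x T| ≤ M := by
  obtain ⟨M, hM⟩ := (Set.finite_range fun a : Fin z × Finset S => |vs a.1 a.2|).bddAbove
  exact ⟨M, fun x T => hM ⟨(x, T), rfl⟩⟩

/-! ### The ascending auction -/

section Auction

variable [DecidableEq S] {z : ℕ}

/-- The prices faced by a bidder holding `A`: other items cost an increment `ε` more. -/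
def bidPrice (ε : ℝ) (q : S → ℝ) (A : Finset S) (j : S) : ℝ :=
  if j ∈ A then q j else q j + ε

/-- A state of the ascending auction with reserve prices `p` and bid increment `ε`: at current
prices `q` bidder `x` holds `A x`, which it can extend to a bundle it demands, and unheld items
are still at their reserve price. -/
structure IsAuctionState_s8 (vs : Fin z → Finset S → ℝ) (p : S → ℝ) (ε : ℝ) (q : S → ℝ)
    (A : Fin z → Finset S) : Prop where
  disjoint : ∀ x y, x ≠ y → Disjoint (A x) (A y)
  reserve_le : ∀ j, p j ≤ q j
  eq_reserve : ∀ j, (∀ x, j ∉ A x) → q j = p j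
  exists_demands : ∀ x, ∃ D, Demands (vs x) (bidPrice ε q (A x)) D ∧ A x ⊆ D

theorem IsAuctionState_s8.price_le {vs : Fin z → Finset S → ℝ} {p q : S → ℝ} {ε : ℝ}
    {A : Fin z → Finset S} (h : IsAuctionState_s8 vs p ε q A) {M : ℝ}
    (hM : ∀ x T, |vs x T| ≤ M) (j : S) : q j ≤ max (p j) (2 * M) := by
  by_cases hj : ∀ x, j ∉ A x
  · exact (h.eq_reserve j hj).le.trans (le_max_left _ _)
  · push Not at hj
    obtain ⟨x, hx⟩ := hj
    obtain ⟨D, hD, hAD⟩ := h.exists_demands x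
    have h1 := hD.price_le (hAD hx)
    rw [bidPrice, if_pos hx] at h1
    have h2 := abs_le.1 (hM x D)
    have h3 := abs_le.1 (hM x (D.erase j))
    exact le_max_of_le_right (by linarith)

/-- If bidder `x` is not content, it can overbid the others, which raises the prices. -/
theorem IsAuctionState_s8.exists_step [Fintype S] {vs : Fin z → Finset S → ℝ}
    (hvs : ∀ x, GrossSubstitutes (vs x)) {p q : S → ℝ} {ε : ℝ} (hε : 0 < ε)
    {A : Fin z → Finset S} (h : IsAuctionState_s8 vs p ε q A) {x : Fin z}
    (hx : ¬ Demands (vs x) (bidPrice ε q (A x)) (A x)) :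
    ∃ q' A', IsAuctionState_s8 vs p ε q' A' ∧ (∀ j x, j ∈ A x → ∃ y, j ∈ A' y) ∧
      ∑ j, q j + ε ≤ ∑ j, q' j := by
  obtain ⟨D, hD, hAD⟩ := h.exists_demands x
  have hne : A x ≠ D := fun e => hx (e ▸ hD)
  obtain ⟨i, hiD, hiA⟩ : ∃ i ∈ D, i ∉ A x :=
    Finset.exists_of_ssubset (hAD.ssubset_of_ne hne)
  refine ⟨fun j => if j ∈ D \ A x then q j + ε else q j,
    fun y => if y = x then D else A y \ D, ⟨?_, ?_, ?_, ?_⟩, ?_, ?_⟩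
  · intro y w hyw
    have hd := h.disjoint y w hyw
    rw [Finset.disjoint_left] at hd ⊢
    intro j
    by_cases hy : y = x <;> by_cases hw : w = x <;> grind
  · intro j
    have := h.reserve_le j
    split_ifs <;> linarith
  · intro j hj
    have hjD : j ∉ D := by simpa using hj x
    have hjA : ∀ y, j ∉ A y := fun y hy => by
      have h1 := hj y
      by_cases hyx : y = x
      · subst hyx
        exact hjD (hAD hy)
      · simp [hyx, hy, hjD] at h1
    simp [hjD, h.eq_reserve j hjA]
  · intro y
    by_cases hy : y = x
    · subst hy
      refine ⟨D, ?_, by simp⟩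
      convert hD using 1
      ext j
      have := @hAD j
      simp only [bidPrice, if_true, Finset.mem_sdiff]
      grind
    · obtain ⟨E, hE, hAE⟩ := h.exists_demands y
      obtain ⟨E', hE', hEE'⟩ := hvs y _ (bidPrice ε
        (fun j => if j ∈ D \ A x then q j + ε else q j) (A y \ D)) (fun j => by
          simp only [bidPrice, Finset.mem_sdiff]
          split_ifs <;> grind) E hE
      refine ⟨E', by simpa [hy] using hE', fun j hj => ?_⟩
      simp only [hy, if_false, Finset.mem_sdiff] at hj
      exact hEE' j (hAE hj.1) (by simp [bidPrice, hj.1, hj.2])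
  · intro j y hj
    by_cases hjD : j ∈ D
    · exact ⟨x, by simpa using hjD⟩
    · exact ⟨y, by by_cases hy : y = x <;> grind⟩
  · have hle : ∀ j, q j + (if j = i then ε else 0) ≤
        if j ∈ D \ A x then q j + ε else q j := by
      intro j
      by_cases hj : j = i
      · subst hj
        simp [hiD, hiA]
      · simp only [hj, if_false]
        split_ifs <;> linarith
    simpa [Finset.sum_add_distrib] using Finset.sum_le_sum fun j (_ : j ∈ Finset.univ) => hle j

/-- The ascending auction terminates, and items that are held stay held. -/
theorem IsAuctionState_s8.exists_terminal [Fintype S] {vs : Fin z → Finset S → ℝ}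
    (hvs : ∀ x, GrossSubstitutes (vs x)) {p q : S → ℝ} {ε : ℝ} (hε : 0 < ε)
    {A : Fin z → Finset S} (h : IsAuctionState_s8 vs p ε q A) :
    ∃ q' A', IsAuctionState_s8 vs p ε q' A' ∧ (∀ j x, j ∈ A x → ∃ y, j ∈ A' y) ∧
      ∀ x, Demands (vs x) (bidPrice ε q' (A' x)) (A' x) := by
  obtain ⟨M, hM⟩ := exists_abs_le vs
  obtain ⟨n, hn⟩ := exists_nat_gt ((∑ j, max (p j) (2 * M) - ∑ j, q j) / ε)
  rw [div_lt_iff₀ hε] at hn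
  induction n generalizing q A with
  | zero =>
    have := Finset.sum_le_sum fun j (_ : j ∈ Finset.univ) => h.price_le hM j
    simp only [Nat.cast_zero, zero_mul] at hn
    linarith
  | succ n ih =>
    by_cases hx : ∀ x, Demands (vs x) (bidPrice ε q (A x)) (A x)
    · exact ⟨q, A, h, fun j x hj => ⟨x, hj⟩, hx⟩
    · push Not at hx
      obtain ⟨x, hx⟩ := hx
      obtain ⟨q₁, A₁, h₁, hA₁, hq₁⟩ := h.exists_step hvs hε hx
      obtain ⟨q₂, A₂, h₂, hA₂, hd⟩ := ih h₁ (by push_cast at hn; linarith)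
      exact ⟨q₂, A₂, h₂, fun j y hj => (hA₁ j y hj).elim fun w hw => hA₂ j w hw, hd⟩

/-- Prices at which bidders can extend their holdings to demanded bundles can be used to start
an auction. -/
theorem IsAuctionState_s8.of_demands {vs : Fin z → Finset S → ℝ}
    (hvs : ∀ x, GrossSubstitutes (vs x)) {p q : S → ℝ} {ε : ℝ} (hε : 0 ≤ ε)
    {A D : Fin z → Finset S} (hA : ∀ x y, x ≠ y → Disjoint (A x) (A y))
    (hpq : ∀ j, p j ≤ q j) (hq : ∀ j, (∀ x, j ∉ A x) → q j = p j)
    (hD : ∀ x, Demands (vs x) q (D x)) (hAD : ∀ x, A x ⊆ D x) :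
    IsAuctionState_s8 vs p ε q A := by
  refine ⟨hA, hpq, hq, fun x => ?_⟩
  obtain ⟨E, hE, hDE⟩ := hvs x q (bidPrice ε q (A x))
    (fun j => by unfold bidPrice; split_ifs <;> linarith) (D x) (hD x)
  exact ⟨E, hE, fun j hj => hDE j (hAD x hj) (by simp [bidPrice, hj])⟩

/-- Weak duality is tight up to a multiple of `ε` at the end of the auction. -/
theorem IsAuctionState_s8.sum_qUtil_le [Fintype S] {vs : Fin z → Finset S → ℝ} {p q : S → ℝ}
    {ε : ℝ} (hε : 0 ≤ ε) {A : Fin z → Finset S} (h : IsAuctionState_s8 vs p ε q A)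
    (hA : ∀ x, Demands (vs x) (bidPrice ε q (A x)) (A x)) (C : Fin z → Finset S) :
    ∑ x, qUtil (vs x) q (C x) + ∑ j, (q j - p j) ≤
      qUtil (convolution vs) p (Finset.univ.biUnion A) + z * Fintype.card S * ε := by
  have hpart : IsPartitionInto A (Finset.univ.biUnion A) := ⟨h.disjoint, rfl⟩
  have h1 : ∀ x, qUtil (vs x) q (C x) ≤ qUtil (vs x) q (A x) + Fintype.card S * ε := by
    intro x
    have h2 := hA x (C x)
    have h3 : ∑ j ∈ A x, bidPrice ε q (A x) j = ∑ j ∈ A x, q j :=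
      Finset.sum_congr rfl fun j hj => by simp [bidPrice, hj]
    have h4 : ∑ j ∈ C x, bidPrice ε q (A x) j ≤ ∑ j ∈ C x, (q j + ε) :=
      Finset.sum_le_sum fun j _ => by unfold bidPrice; split_ifs <;> linarith
    have h5 : ((C x).card : ℝ) * ε ≤ Fintype.card S * ε := by
      gcongr
      exact Finset.card_le_univ _
    simp only [Finset.sum_add_distrib, Finset.sum_const, nsmul_eq_mul] at h4
    simp only [qUtil] at h2 ⊢
    linarith
  have h2 := Finset.sum_le_sum fun x (_ : x ∈ Finset.univ) => h1 x
  simp only [Finset.sum_add_distrib, Finset.sum_const, Finset.card_univ, Fintype.card_fin,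
    nsmul_eq_mul] at h2
  have h3 : ∑ j, (q j - p j) = ∑ j ∈ Finset.univ.biUnion A, (q j - p j) := by
    refine (Finset.sum_subset (Finset.subset_univ _) fun j _ hj => ?_).symm
    rw [h.eq_reserve j fun x hx => hj (Finset.mem_biUnion.2 ⟨x, Finset.mem_univ _, hx⟩), sub_self]
  have h4 := sum_qUtil_add_sum_sub vs p q hpart
  have h5 := le_convolution vs hpart
  rw [qUtil]
  linarith

end Auction

/-- Every optimal allocation is supported by equilibrium prices. -/
theorem exists_supporting_prices [Fintype S] [DecidableEq S] {z : ℕ}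
    {vs : Fin z → Finset S → ℝ} (hvs : ∀ x, GrossSubstitutes (vs x)) {p : S → ℝ}
    {A : Fin z → Finset S} {T : Finset S} (hA : IsPartitionInto A T)
    (hAT : convolution vs T = ∑ x, vs x (A x)) (hT : Demands (convolution vs) p T) :
    ∃ q : S → ℝ, (∀ j, p j ≤ q j) ∧ (∀ j ∉ T, q j = p j) ∧ ∀ x, Demands (vs x) q (A x) := by
  obtain ⟨M, hM⟩ := exists_abs_le vs
  have happrox : ∀ n : ℕ, ∃ q ∈ Set.Icc p fun j => max (p j) (2 * M), ∀ C : Fin z → Finset S,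
      ∑ x, qUtil (vs x) q (C x) + ∑ j, (q j - p j) ≤
        ∑ x, qUtil (vs x) q (A x) + ∑ j ∈ T, (q j - p j) +
          z * Fintype.card S * (1 / ((n : ℝ) + 1)) := by
    intro n
    have hε : (0 : ℝ) < 1 / ((n : ℝ) + 1) := Nat.one_div_pos_of_nat
    choose D hD using fun x => exists_demands (vs x) p
    have h0 : IsAuctionState_s8 vs p (1 / ((n : ℝ) + 1)) p fun _ => ∅ :=
      .of_demands hvs hε.le (by simp) (fun _ => le_rfl) (fun _ _ => rfl) hD (by simp)
    obtain ⟨q, B, hB, -, hd⟩ := h0.exists_terminal hvs hε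
    refine ⟨q, ⟨hB.reserve_le, hB.price_le hM⟩, fun C => ?_⟩
    have h1 := hB.sum_qUtil_le hε.le hd C
    have h2 := hT (Finset.univ.biUnion B)
    have h3 := sum_qUtil_add_sum_sub vs p q hA
    rw [qUtil.eq_1 _ _ T, hAT] at h2
    linarith
  choose q hq hqC using happrox
  obtain ⟨r, hr, φ, hφ, hlim⟩ := isCompact_Icc.tendsto_subseq hq
  have hzero : Filter.Tendsto (fun n => (z : ℝ) * Fintype.card S * (1 / ((φ n : ℝ) + 1)))
      Filter.atTop (nhds 0) := by
    simpa using (tendsto_one_div_add_atTop_nhds_zero_nat.comp hφ.tendsto_atTop).const_mul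
      ((z : ℝ) * Fintype.card S)
  have hlimit : ∀ C : Fin z → Finset S, ∑ x, qUtil (vs x) r (C x) + ∑ j, (r j - p j) ≤
      ∑ x, qUtil (vs x) r (A x) + ∑ j ∈ T, (r j - p j) := by
    intro C
    have hcont : ∀ (C : Fin z → Finset S) (U : Finset S), Continuous fun q : S → ℝ =>
        ∑ x, qUtil (vs x) q (C x) + ∑ j ∈ U, (q j - p j) := by
      intro C U
      unfold qUtil
      fun_prop
    refine le_of_tendsto_of_tendsto' (((hcont C Finset.univ).tendsto r).comp hlim)
      ?_ fun n => hqC (φ n) C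
    simpa using (((hcont A T).tendsto r).comp hlim).add hzero
  have hsplit := Finset.sum_add_sum_compl T fun j => r j - p j
  have hnonneg : ∀ j, 0 ≤ r j - p j := fun j => sub_nonneg.2 (hr.1 j)
  have hcompl : 0 ≤ ∑ j ∈ Tᶜ, (r j - p j) := Finset.sum_nonneg fun j _ => hnonneg j
  refine ⟨r, hr.1, fun j hj => ?_, fun x U => ?_⟩
  · have h1 := hlimit A
    have h2 := Finset.single_le_sum (fun j _ => hnonneg j) (Finset.mem_compl.2 hj)
    linarith [hnonneg j]
  · have h1 := hlimit (Function.update A x U)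
    have h2 : ∑ y, qUtil (vs y) r (Function.update A x U y) - ∑ y, qUtil (vs y) r (A y) =
        qUtil (vs x) r U - qUtil (vs x) r (A x) := by
      rw [← Finset.sum_sub_distrib, Finset.sum_eq_single x]
      · simp
      · intro y _ hy
        simp [hy]
      · simp
    linarith

/-- The convolution of gross substitutes valuations satisfies gross substitutes. -/
theorem convolution_grossSubstitutes
    [Fintype S] [DecidableEq S] {z : ℕ} (vs : Fin z → Finset S → ℝ)
    (hvs : ∀ x, GrossSubstitutes (vs x)) :
    GrossSubstitutes (convolution vs) := by
  rcases Nat.eq_zero_or_pos z with rfl | hz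
  · convert grossSubstitutes_const (S := S) 0 using 1
    ext T
    refine le_antisymm (Real.sSup_nonpos ?_) (Real.sSup_nonneg ?_) <;>
    · rintro r ⟨π, -, rfl⟩
      simp
  have : NeZero z := ⟨hz.ne'⟩
  intro p p' hpp' T hT
  obtain ⟨A, hA, hAT⟩ := exists_isPartitionInto_convolution_eq vs T
  obtain ⟨q, hpq, hqT, hqA⟩ := exists_supporting_prices hvs hA hAT hT
  choose D hD hAD using fun x => hvs x q (fun j => max (q j) (p' j))
    (fun j => le_max_left _ _) (A x) (hqA x)
  have happrox : ∀ ε : ℝ, 0 < ε → ∃ T', (∀ j ∈ T, p j = p' j → j ∈ T') ∧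
      ∀ U, qUtil (convolution vs) p' U ≤
        qUtil (convolution vs) p' T' + z * Fintype.card S * ε := by
    intro ε hε
    have h0 : IsAuctionState_s8 vs p' ε (fun j => max (q j) (p' j))
        fun x => (A x).filter fun j => p' j ≤ q j := by
      refine .of_demands hvs hε.le (fun x y hxy => ?_) (fun j => le_max_right _ _)
        (fun j hj => max_eq_right ?_) hD fun x j hj => ?_
      · exact Finset.disjoint_filter_filter (hA.1 x y hxy)
      · by_cases hjT : j ∈ T
        · rw [← hA.2, Finset.mem_biUnion] at hjT
          obtain ⟨x, -, hx⟩ := hjT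
          have := hj x
          simp only [Finset.mem_filter, hx, true_and, not_le] at this
          exact this.le
        · exact (hqT j hjT).le.trans (hpp' j)
      · rw [Finset.mem_filter] at hj
        exact hAD x j hj.1 (max_eq_left hj.2).symm
    obtain ⟨r, B, hB, hheld, hd⟩ := h0.exists_terminal hvs hε
    refine ⟨Finset.univ.biUnion B, fun j hj hpj => ?_, fun U => ?_⟩
    · rw [← hA.2, Finset.mem_biUnion] at hj
      obtain ⟨x, -, hx⟩ := hj
      obtain ⟨y, hy⟩ := hheld j x (Finset.mem_filter.2 ⟨hx, hpj ▸ hpq j⟩)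
      exact Finset.mem_biUnion.2 ⟨y, Finset.mem_univ _, hy⟩
    · obtain ⟨C, hC, hCU⟩ := exists_isPartitionInto_convolution_eq vs U
      have h1 := hB.sum_qUtil_le hε.le hd C
      have h2 := sum_qUtil_add_sum_sub vs p' r hC
      have h3 : ∑ j ∈ U, (r j - p' j) ≤ ∑ j, (r j - p' j) :=
        Finset.sum_le_sum_of_subset_of_nonneg (Finset.subset_univ _)
          fun j _ _ => sub_nonneg.2 (hB.reserve_le j)
      rw [qUtil.eq_1 _ _ U, hCU]
      linarith
  obtain ⟨T', hT', hmax⟩ := Finset.exists_max_image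
    (Finset.univ.filter fun T' : Finset S => ∀ j ∈ T, p j = p' j → j ∈ T')
    (qUtil (convolution vs) p') ⟨T, by simp +contextual⟩
  refine ⟨T', fun U => le_of_forall_pos_le_add fun δ hδ => ?_, (Finset.mem_filter.1 hT').2⟩
  have hc : (0 : ℝ) < z * Fintype.card S + 1 := by positivity
  obtain ⟨V, hV, hVU⟩ := happrox (δ / (z * Fintype.card S + 1)) (by positivity)
  have h1 := hmax V (Finset.mem_filter.2 ⟨Finset.mem_univ _, hV⟩)
  have h2 : (z : ℝ) * Fintype.card S * (δ / (z * Fintype.card S + 1)) ≤ δ := by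
    rw [← mul_div_assoc, div_le_iff₀ hc]
    linarith
  linarith [hVU U]
end

section
/- Assume each effective price function q_{ij} is piecewise linear with right derivative q'_{ij} > 0. Let (ν, p) be a feasible and partially stable many-to-one outcome in the QITU model with gross substitutes valuations, with many-to-many projection μ, and let T be a MAT rooted at k0 in D(ν,p) with |ν(j)| = cap(j) for all j ∈ S(T). Let M_B = (W(T), I_B) be the buyer demand matroid and let M_S = (W(T), I_S) be the partition matroid with I_S = {E ⊆ W(T) : |E(j)| ≤ cap(j) for all j ∈ S(T)}, where E(j) = {(i,j) ∈ E}. Let μ* be a common basis of M_B and M_S minimizing Σ_{(i,j)∈μ*} log q'_{ij}(p_j). Then any lift ν* of μ* (a many-to-one matching whose many-to-many projection is μ*) is a minimum weight partially stable perfect matching on the unit-buyers U(T)∖{k0} and items S(T), where the weight of an edge (k,j) is log q'_{kj}(p_j): ν* matches every unit-buyer in U(T)∖{k0}, matches every item j ∈ S(T) to exactly cap(j) unit-buyers, (ν ∖ E(T)) ∪ ν* is partially stable at p, and ν* has minimum total weight among all such matchings. -/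
open Finset

variable {B S : Type*}

section QITU

variable [DecidableEq B] [DecidableEq S]

/-- Utility of buyer `i` for bundle `T` at prices `p` in the QITU model. -/
def uQ (v : B → Finset S → ℝ) (q : B → S → ℝ → ℝ) (i : B) (p : S → ℝ)
    (T : Finset S) : ℝ :=
  v i T - ∑ j ∈ T, q i j (p j)

/-- Gross substitutes for buyer `i` in the QITU model. -/
def QGS (v : B → Finset S → ℝ) (q : B → S → ℝ → ℝ) (i : B) : Prop :=
  ∀ p p' : S → ℝ, (∀ j, 0 ≤ p j) → (∀ j, p j ≤ p' j) →
    ∀ T : Finset S, (∀ T' : Finset S, uQ v q i p T' ≤ uQ v q i p T) →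
      ∃ T' : Finset S, (∀ T'' : Finset S, uQ v q i p' T'' ≤ uQ v q i p' T') ∧
        ∀ j ∈ T, p j = p' j → j ∈ T'

/-- The right derivative of `f` at `x`. -/
noncomputable def rightDeriv (f : ℝ → ℝ) (x : ℝ) : ℝ :=
  derivWithin f (Set.Ici x) x

/-- A many-to-one matching between unit-buyers (`B × S`, with the second coordinate a
copy label) and items: each unit-buyer gets at most one item, each item `j` at most
`cap j` unit-buyers, and no two copies of the same buyer share an item. -/
structure IsMTO (cap : S → ℕ) (ν : Finset ((B × S) × S)) : Prop where
  unit : ∀ k : B × S, (ν.filter fun e => e.1 = k).card ≤ 1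
  cap_le : ∀ j : S, (ν.filter fun e => e.2 = j).card ≤ cap j
  nodup : ∀ k k' : B × S, ∀ j : S, (k, j) ∈ ν → (k', j) ∈ ν → k.1 = k'.1 → k = k'

/-- The bundle matched (through all its unit-buyers) to buyer `i`; this is the bundle of
`i` in the many-to-many projection. -/
def bundleOf (ν : Finset ((B × S) × S)) (i : B) : Finset S :=
  (ν.filter fun e => e.1.1 = i).image Prod.snd

/-- Number of unit-buyers matched to item `j`. -/
def itemDeg (ν : Finset ((B × S) × S)) (j : S) : ℕ :=
  (ν.filter fun e => e.2 = j).card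

/-- Feasibility: undermatched items have price zero. -/
def FeasibleMTO (cap : S → ℕ) (ν : Finset ((B × S) × S)) (p : S → ℝ) : Prop :=
  ∀ j : S, itemDeg ν j < cap j → p j = 0

/-- Partial stability: each buyer's bundle maximizes utility among bundles of at most the
same size. -/
def PartStable (v : B → Finset S → ℝ) (q : B → S → ℝ → ℝ)
    (ν : Finset ((B × S) × S)) (p : S → ℝ) : Prop :=
  ∀ i : B, ∀ T : Finset S, T.card ≤ (bundleOf ν i).card →
    uQ v q i p T ≤ uQ v q i p (bundleOf ν i)

/-- The item `j1` belongs to the marginal demand correspondence of unit-buyer `k`, i.e.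
`(k, j1)` is an edge of the marginal demand graph `D(ν, p)`. -/
def InMDG (v : B → Finset S → ℝ) (q : B → S → ℝ → ℝ) (ν : Finset ((B × S) × S))
    (p : S → ℝ) (k : B × S) (j1 : S) : Prop :=
  (k, j1) ∈ ν ∨
  (j1 ∉ bundleOf ν k.1 ∧ ∃ j0 : S, (k, j0) ∈ ν ∧ j0 ≠ j1 ∧
    uQ v q k.1 p (insert j1 ((bundleOf ν k.1).erase j0)) = uQ v q k.1 p (bundleOf ν k.1)) ∨
  (j1 ∉ bundleOf ν k.1 ∧ (∀ j : S, (k, j) ∉ ν) ∧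
    0 ≤ uQ v q k.1 p (insert j1 (bundleOf ν k.1)) - uQ v q k.1 p (bundleOf ν k.1) ∧
    ∀ j2 : S, j2 ∉ bundleOf ν k.1 →
      uQ v q k.1 p (insert j2 (bundleOf ν k.1)) ≤ uQ v q k.1 p (insert j1 (bundleOf ν k.1)))

/-- Vertices of an edge set, in the bipartite vertex type (unit-buyers ⊕ items). -/
def treeVerts (T : Finset ((B × S) × S)) : Set ((B × S) ⊕ S) :=
  {x | ∃ e ∈ T, x = Sum.inl e.1 ∨ x = Sum.inr e.2}

/-- The simple graph, on unit-buyers ⊕ items, spanned by an edge set. -/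
def graphOf (T : Finset ((B × S) × S)) : SimpleGraph ((B × S) ⊕ S) :=
  SimpleGraph.fromEdgeSet {e | ∃ kj ∈ T, e = s(Sum.inl kj.1, Sum.inr kj.2)}

/-- The (Sym2) edge corresponds to a matched pair of `ν`. -/
def matchedSym (ν : Finset ((B × S) × S)) (e : Sym2 ((B × S) ⊕ S)) : Prop :=
  ∃ kj ∈ ν, e = s(Sum.inl kj.1, Sum.inr kj.2)

/-- An alternating tree, in the graph with edge relation `H`, rooted at the unmatched
unit-buyer `k0`: a tree all of whose root-paths alternate between unmatched and matched
edges, starting with an unmatched edge. -/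
structure IsAltTree (H : (B × S) → S → Prop) (ν : Finset ((B × S) × S))
    (k0 : B × S) (T : Finset ((B × S) × S)) : Prop where
  root_unmatched : ∀ j : S, (k0, j) ∉ ν
  subgraph : ∀ e ∈ T, H e.1 e.2
  acyclic : (graphOf T).IsAcyclic
  conn : ∀ x ∈ treeVerts T, (graphOf T).Reachable (Sum.inl k0) x
  alternating : ∀ (x : (B × S) ⊕ S) (w : (graphOf T).Walk (Sum.inl k0) x), w.IsPath →
    ∀ (n : ℕ) (hn : n < w.edges.length), (matchedSym ν (w.edges.get ⟨n, hn⟩) ↔ Odd n)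

/-- A maximal alternating tree (MAT): an alternating tree closed under taking all
`H`-neighbors of its unit-buyers and all `ν`-matches of its items. -/
structure IsMAT (H : (B × S) → S → Prop) (ν : Finset ((B × S) × S))
    (k0 : B × S) (T : Finset ((B × S) × S)) extends IsAltTree H ν k0 T : Prop where
  buyer_closed : ∀ k : B × S, (Sum.inl k ∈ treeVerts T ∨ k = k0) →
    ∀ j : S, H k j → Sum.inr j ∈ treeVerts T
  item_closed : ∀ j : S, Sum.inr j ∈ treeVerts T →
    ∀ k : B × S, (k, j) ∈ ν → Sum.inl k ∈ treeVerts T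

end QITU

section Matroid

variable [DecidableEq B] [DecidableEq S]

/-- Unit-buyers appearing in (the edges of) a tree. -/
def treeUnitBuyers (T : Finset ((B × S) × S)) : Finset (B × S) :=
  T.image Prod.fst

/-- Items appearing in (the edges of) a tree. -/
def treeItems (T : Finset ((B × S) × S)) : Finset S :=
  T.image Prod.snd

/-- The buyers `B'(T)` owning a non-root unit-buyer of the tree. -/
def treeBuyers (T : Finset ((B × S) × S)) (k0 : B × S) : Finset B :=
  ((treeUnitBuyers T).erase k0).image Prod.fst

/-- The number `|U'(T) ∩ ubuy(i)|` of non-root unit-buyer copies of buyer `i` in the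
tree. -/
def copiesInTree (T : Finset ((B × S) × S)) (k0 : B × S) (i : B) : ℕ :=
  (((treeUnitBuyers T).erase k0).filter fun k => k.1 = i).card

/-- The marginal utility `u_i(S(F) | μ(i) ∖ S(T), p)` of the items of an edge set `F`
for buyer `i`, given the part of `i`'s bundle outside of the tree. -/
def margUtil (v : B → Finset S → ℝ) (q : B → S → ℝ → ℝ) (p : S → ℝ)
    (ν T : Finset ((B × S) × S)) (i : B) (F : Finset (B × S)) : ℝ :=
  uQ v q i p ((F.image Prod.snd) ∪ (bundleOf ν i \ treeItems T)) -
    uQ v q i p (bundleOf ν i \ treeItems T)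

/-- The family `J_B`: unions over buyers `i ∈ B'(T)` of edge sets `S_i ⊆ {i} × S(T)` of
size `|U'(T) ∩ ubuy(i)|` maximizing the marginal utility `u_i(S(F) | μ(i) ∖ S(T), p)`
among all such edge sets. -/
def demandBases (v : B → Finset S → ℝ) (q : B → S → ℝ → ℝ) (p : S → ℝ)
    (ν T : Finset ((B × S) × S)) (k0 : B × S) : Set (Finset (B × S)) :=
  {E | ∃ f : B → Finset (B × S),
    (∀ i ∈ treeBuyers T k0,
      f i ⊆ ({i} : Finset B) ×ˢ treeItems T ∧
      (f i).card = copiesInTree T k0 i ∧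
      ∀ F : Finset (B × S), F ⊆ ({i} : Finset B) ×ˢ treeItems T →
        F.card = copiesInTree T k0 i →
        margUtil v q p ν T i F ≤ margUtil v q p ν T i (f i)) ∧
    E = (treeBuyers T k0).biUnion f}

/-- The family `I_B` of all subsets of members of `J_B`. -/
def demandIndep (v : B → Finset S → ℝ) (q : B → S → ℝ → ℝ) (p : S → ℝ)
    (ν T : Finset ((B × S) × S)) (k0 : B × S) : Set (Finset (B × S)) :=
  {A | ∃ E ∈ demandBases v q p ν T k0, A ⊆ E}

end Matroid

section PSPM

variable [DecidableEq B] [DecidableEq S]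


/-- A partially stable perfect matching on `U(T) ∖ {k0}` and `S(T)`: it matches every
non-root unit-buyer of the tree (each to one item), matches every item `j ∈ S(T)` to
exactly `cap j` unit-buyers, never matches two copies of the same buyer to the same
item, and together with the rest of `ν` outside the tree is partially stable at `p`. -/
structure IsPSPM (cap : S → ℕ) (v : B → Finset S → ℝ) (q : B → S → ℝ → ℝ) (p : S → ℝ)
    (ν T : Finset ((B × S) × S)) (k0 : B × S)
    (ν' : Finset ((B × S) × S)) : Prop where
  edges : ∀ e ∈ ν', e.1 ∈ (treeUnitBuyers T).erase k0 ∧ e.2 ∈ treeItems T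
  covers : ∀ k ∈ (treeUnitBuyers T).erase k0, ∃ j : S, (k, j) ∈ ν'
  unit : ∀ k : B × S, (ν'.filter fun e => e.1 = k).card ≤ 1
  saturates : ∀ j ∈ treeItems T, (ν'.filter fun e => e.2 = j).card = cap j
  nodup : ∀ k k' : B × S, ∀ j : S, (k, j) ∈ ν' → (k', j) ∈ ν' → k.1 = k'.1 → k = k'
  stable : PartStable v q ((ν \ T) ∪ ν') p

/-- Total weight `Σ log q'_{kj}(p_j)` of a many-to-one matching. -/
noncomputable def wtU (q : B → S → ℝ → ℝ) (p : S → ℝ)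
    (ν : Finset ((B × S) × S)) : ℝ :=
  ∑ e ∈ ν, Real.log (rightDeriv (q e.1.1 e.2) (p e.2))

end PSPM

section Stmt15

variable [DecidableEq B] [DecidableEq S]

/-- The independent sets of the item capacity (partition) matroid `M_S` on the ground
set `W(T) = B'(T) × S(T)`. -/
def capIndep (cap : S → ℕ) (T : Finset ((B × S) × S)) (k0 : B × S) :
    Set (Finset (B × S)) :=
  {E | E ⊆ treeBuyers T k0 ×ˢ treeItems T ∧
    ∀ j ∈ treeItems T, (E.filter fun e => e.2 = j).card ≤ cap j}

/-- Total weight `Σ log q'_{ij}(p_j)` of a buyer-level edge set. -/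
noncomputable def wtB (q : B → S → ℝ → ℝ) (p : S → ℝ) (E : Finset (B × S)) : ℝ :=
  ∑ e ∈ E, Real.log (rightDeriv (q e.1 e.2) (p e.2))

end Stmt15

section TreeMatching

lemma even_length_graphOf_iff {T : Finset ((B × S) × S)} {x y : (B × S) ⊕ S}
    (w : (graphOf T).Walk x y) : Even w.length ↔ x.isLeft = y.isLeft := by
  induction w with
  | nil => simp
  | cons h w ih =>
    have h' : _ ∧ _ := (SimpleGraph.fromEdgeSet_adj _).1 h
    obtain ⟨⟨kj, -, he⟩, -⟩ := h'
    rw [SimpleGraph.Walk.length_cons, Nat.even_add_one, ih]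
    rcases Sym2.eq_iff.1 he with ⟨rfl, rfl⟩ | ⟨rfl, rfl⟩ <;> simp

lemma mem_treeVerts_inr [DecidableEq S] {T : Finset ((B × S) × S)} {j : S} :
    Sum.inr j ∈ treeVerts T ↔ j ∈ treeItems T := by
  simp [treeVerts, treeItems]

lemma injOn_proj_of_nodup {ν : Finset ((B × S) × S)}
    (hnodup : ∀ k k' : B × S, ∀ j : S, (k, j) ∈ ν → (k', j) ∈ ν → k.1 = k'.1 → k = k') :
    Set.InjOn (fun e : (B × S) × S => (e.1.1, e.2)) (ν : Set ((B × S) × S)) := by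
  rintro ⟨k, j⟩ he ⟨k', j'⟩ he' h
  obtain ⟨h1, h2⟩ := Prod.mk.inj h
  dsimp only at h1 h2
  subst h2
  rw [hnodup k k' j he he' h1]

lemma image_snd_singleton_product [DecidableEq S] (i : B) (J : Finset S) :
    (({i} : Finset B) ×ˢ J).image Prod.snd = J := by
  ext; simp

variable [DecidableEq B] [DecidableEq S]

lemma mem_treeVerts_inl {T : Finset ((B × S) × S)} {k : B × S} :
    Sum.inl k ∈ treeVerts T ↔ k ∈ treeUnitBuyers T := by
  simp only [treeVerts, treeUnitBuyers, Set.mem_ofPred_eq, mem_image, Sum.inl.injEq, reduceCtorEq,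
    or_false, eq_comm]

lemma mem_bundleOf {ν : Finset ((B × S) × S)} {i : B} {j : S} :
    j ∈ bundleOf ν i ↔ ∃ c, ((i, c), j) ∈ ν := by
  simp only [bundleOf, mem_image, mem_filter, Prod.exists]
  constructor
  · rintro ⟨a, c, j', ⟨h, rfl⟩, rfl⟩
    exact ⟨c, h⟩
  · rintro ⟨c, h⟩
    exact ⟨i, c, j, ⟨h, rfl⟩, rfl⟩

lemma mem_treeBuyers {T : Finset ((B × S) × S)} {k0 : B × S} {i : B} :
    i ∈ treeBuyers T k0 ↔ ∃ c, (i, c) ∈ (treeUnitBuyers T).erase k0 := by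
  simp only [treeBuyers, mem_image, Prod.exists]
  constructor
  · rintro ⟨a, c, h, rfl⟩
    exact ⟨c, h⟩
  · rintro ⟨c, h⟩
    exact ⟨i, c, h, rfl⟩

/-- Every non-root unit-buyer of an alternating tree is matched along a tree edge. -/
lemma IsAltTree.exists_matched_edge {H : (B × S) → S → Prop} {ν T : Finset ((B × S) × S)}
    {k0 k : B × S} (hT : IsAltTree H ν k0 T) (hk : k ∈ (treeUnitBuyers T).erase k0) :
    ∃ j, (k, j) ∈ ν ∧ (k, j) ∈ T := by
  obtain ⟨hne, hk⟩ := mem_erase.1 hk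
  obtain ⟨w, hw⟩ := (hT.conn _ (mem_treeVerts_inl.2 hk)).exists_isPath
  have heven : Even w.length := (even_length_graphOf_iff w).2 rfl
  have hpos : 0 < w.length := by
    rcases Nat.eq_zero_or_pos w.length with h | h
    · exact absurd (Sum.inl.inj (SimpleGraph.Walk.eq_of_length_eq_zero h)).symm hne
    · exact h
  have hn : w.length - 1 < w.edges.length := by
    rw [SimpleGraph.Walk.length_edges]; omega
  have hodd : Odd (w.length - 1) := by
    obtain ⟨m, hm⟩ := heven
    exact ⟨m - 1, by omega⟩
  obtain ⟨kj, hkj, he⟩ := (hT.alternating _ w hw _ hn).2 hodd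
  have hmemT : s(Sum.inl kj.1, Sum.inr kj.2) ∈ (graphOf T).edgeSet := by
    rw [← he]
    exact w.edges_subset_edgeSet (List.get_mem _ _)
  have hlast : w.edges.get ⟨w.length - 1, hn⟩ = s(w.penultimate, Sum.inl k) := by
    rw [List.get_eq_getElem, SimpleGraph.Walk.getElem_edges, SimpleGraph.Walk.penultimate,
      Nat.sub_add_cancel hpos, SimpleGraph.Walk.getVert_length]
  have hk1 : kj.1 = k := by
    have : (Sum.inl k : (B × S) ⊕ S) ∈ s(Sum.inl kj.1, Sum.inr kj.2) := by
      rw [← he, hlast]; simp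
    simpa [eq_comm] using this
  subst hk1
  refine ⟨kj.2, hkj, ?_⟩
  rw [graphOf, SimpleGraph.edgeSet_fromEdgeSet] at hmemT
  obtain ⟨⟨e, heT, hee⟩, -⟩ := hmemT
  rcases Sym2.eq_iff.1 hee with ⟨h1, h2⟩ | ⟨h1, h2⟩
  · rw [Sum.inl.inj h1, Sum.inr.inj h2]; exact heT
  · cases h1

/-- The tree edges of the matching are exactly its edges at items of the tree. -/
lemma IsMAT.mem_tree_iff {cap : S → ℕ} {H : (B × S) → S → Prop} {ν T : Finset ((B × S) × S)}
    {k0 : B × S} (hT : IsMAT H ν k0 T) (hν : IsMTO cap ν) {e : (B × S) × S} (he : e ∈ ν) :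
    e ∈ T ↔ e.2 ∈ treeItems T := by
  refine ⟨fun h => mem_image_of_mem _ h, fun h => ?_⟩
  have hk := mem_treeVerts_inl.1 (hT.item_closed _ (mem_treeVerts_inr.2 h) e.1 he)
  have hk0 : e.1 ≠ k0 := fun h0 => hT.root_unmatched e.2 (h0 ▸ he)
  obtain ⟨j, hj, hjT⟩ := hT.exists_matched_edge (mem_erase.2 ⟨hk0, hk⟩)
  have := card_le_one.1 (hν.unit e.1) e (by simp [he]) (e.1, j) (by simp [hj])
  exact this ▸ hjT

/-- A matching of all unit-buyers in `U` into the items in `J` in which no buyer is matched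
twice to the same item. -/
structure IsUnitMatching (U : Finset (B × S)) (J : Finset S) (ν : Finset ((B × S) × S)) :
    Prop where
  edges : ∀ e ∈ ν, e.1 ∈ U ∧ e.2 ∈ J
  covers : ∀ k ∈ U, ∃ j : S, (k, j) ∈ ν
  unit : ∀ k : B × S, (ν.filter fun e => e.1 = k).card ≤ 1
  nodup : ∀ k k' : B × S, ∀ j : S, (k, j) ∈ ν → (k', j) ∈ ν → k.1 = k'.1 → k = k'

lemma injOn_fst_of_unit {ν : Finset ((B × S) × S)}
    (hunit : ∀ k : B × S, (ν.filter fun e => e.1 = k).card ≤ 1) :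
    Set.InjOn Prod.fst (ν : Set ((B × S) × S)) := fun e he e' he' h =>
  card_le_one.1 (hunit e.1) e (by simpa using he) e' (by simpa [h] using he')

lemma wtU_eq_wtB {ν : Finset ((B × S) × S)} (q : B → S → ℝ → ℝ) (p : S → ℝ)
    (hinj : Set.InjOn (fun e : (B × S) × S => (e.1.1, e.2)) (ν : Set ((B × S) × S))) :
    wtU q p ν = wtB q p (ν.image fun e => (e.1.1, e.2)) := by
  rw [wtB, sum_image hinj, wtU]

namespace IsUnitMatching

variable {U : Finset (B × S)} {J : Finset S} {ν : Finset ((B × S) × S)}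

lemma image_fst (h : IsUnitMatching U J ν) : ν.image Prod.fst = U := by
  ext k
  rw [mem_image]
  constructor
  · rintro ⟨e, he, rfl⟩
    exact (h.edges e he).1
  · intro hk
    obtain ⟨j, hj⟩ := h.covers k hk
    exact ⟨_, hj, rfl⟩

lemma card_eq (h : IsUnitMatching U J ν) : ν.card = U.card := by
  rw [← h.image_fst, card_image_of_injOn (injOn_fst_of_unit h.unit)]

lemma card_bundleOf (h : IsUnitMatching U J ν) (i : B) :
    (bundleOf ν i).card = (U.filter fun k => k.1 = i).card := by
  have hU : U.filter (fun k => k.1 = i) = (ν.filter fun e => e.1.1 = i).image Prod.fst := by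
    rw [← h.image_fst, filter_image]
  rw [hU, bundleOf, card_image_of_injOn, card_image_of_injOn]
  · exact (injOn_fst_of_unit h.unit).mono (coe_subset.2 (filter_subset _ _))
  · intro e he e' he' hee
    rw [mem_coe, mem_filter] at he he'
    exact injOn_proj_of_nodup h.nodup he.1 he'.1 (Prod.ext (he.2.trans he'.2.symm) hee)

lemma bundleOf_subset (h : IsUnitMatching U J ν) (i : B) : bundleOf ν i ⊆ J := by
  intro j hj
  obtain ⟨c, hc⟩ := mem_bundleOf.1 hj
  exact (h.edges _ hc).2

lemma card_eq_sum_itemDeg (h : IsUnitMatching U J ν) :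
    ν.card = ∑ j ∈ J, itemDeg ν j :=
  card_eq_sum_card_fiberwise fun e he => (h.edges e he).2

end IsUnitMatching

lemma filter_image_proj_card {ν : Finset ((B × S) × S)} (j : S)
    (hinj : Set.InjOn (fun e : (B × S) × S => (e.1.1, e.2)) (ν : Set ((B × S) × S))) :
    ((ν.image fun e => (e.1.1, e.2)).filter fun e => e.2 = j).card = itemDeg ν j := by
  rw [filter_image, card_image_of_injOn (hinj.mono (coe_subset.2 (filter_subset _ _))), itemDeg]

variable {cap : S → ℕ} {v : B → Finset S → ℝ} {q : B → S → ℝ → ℝ} {p : S → ℝ}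
  {H : (B × S) → S → Prop} {ν T ν' : Finset ((B × S) × S)} {k0 : B × S}

/-- The original matching restricted to the tree. -/
lemma IsMAT.isUnitMatching_inter (hT : IsMAT H ν k0 T) (hν : IsMTO cap ν) :
    IsUnitMatching ((treeUnitBuyers T).erase k0) (treeItems T) (ν ∩ T) where
  edges e he := by
    obtain ⟨he, heT⟩ := mem_inter.1 he
    exact ⟨mem_erase.2 ⟨fun h0 => hT.root_unmatched e.2 (h0 ▸ he), mem_image_of_mem _ heT⟩,
      mem_image_of_mem _ heT⟩
  covers k hk := by
    obtain ⟨j, h⟩ := hT.exists_matched_edge hk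
    exact ⟨j, mem_inter.2 h⟩
  unit k := (card_le_card (filter_subset_filter _ inter_subset_left)).trans (hν.unit k)
  nodup k k' j h h' := hν.nodup k k' j (mem_inter.1 h).1 (mem_inter.1 h').1

lemma IsMAT.itemDeg_inter (hT : IsMAT H ν k0 T) (hν : IsMTO cap ν) {j : S}
    (hj : j ∈ treeItems T) : itemDeg (ν ∩ T) j = itemDeg ν j := by
  rw [itemDeg, itemDeg]
  congr 1
  ext e
  simp only [mem_filter, mem_inter, and_congr_left_iff, and_iff_left_iff_imp]
  rintro rfl he
  exact (hT.mem_tree_iff hν he).2 hj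

/-- The number of non-root unit-buyers of the tree is the total capacity of its items. -/
lemma IsMAT.card_unitBuyers (hT : IsMAT H ν k0 T) (hν : IsMTO cap ν)
    (hfull : ∀ j ∈ treeItems T, itemDeg ν j = cap j) :
    ((treeUnitBuyers T).erase k0).card = ∑ j ∈ treeItems T, cap j := by
  have h := hT.isUnitMatching_inter hν
  rw [← h.card_eq, h.card_eq_sum_itemDeg]
  exact sum_congr rfl fun j hj => (hT.itemDeg_inter hν hj).trans (hfull j hj)

lemma IsMAT.bundleOf_sdiff_union (hT : IsMAT H ν k0 T) (hν : IsMTO cap ν) (i : B) :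
    bundleOf ((ν \ T) ∪ ν') i = bundleOf ν' i ∪ (bundleOf ν i \ treeItems T) := by
  ext j
  simp only [mem_union, mem_sdiff, mem_bundleOf]
  constructor
  · rintro ⟨c, ⟨h, hc⟩ | h⟩
    · exact Or.inr ⟨⟨c, h⟩, fun hj => hc ((hT.mem_tree_iff hν h).2 hj)⟩
    · exact Or.inl ⟨c, h⟩
  · rintro (⟨c, h⟩ | ⟨⟨c, h⟩, hj⟩)
    · exact ⟨c, Or.inr h⟩
    · exact ⟨c, Or.inl ⟨h, fun hc => hj ((hT.mem_tree_iff hν h).1 hc)⟩⟩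

lemma IsMAT.bundleOf_eq (hT : IsMAT H ν k0 T) (hν : IsMTO cap ν) (i : B) :
    bundleOf ν i = bundleOf (ν ∩ T) i ∪ (bundleOf ν i \ treeItems T) := by
  rw [← hT.bundleOf_sdiff_union hν, sdiff_union_inter]

lemma IsUnitMatching.card_union_bundleOf
    (h : IsUnitMatching ((treeUnitBuyers T).erase k0) (treeItems T) ν') (i : B) :
    (bundleOf ν' i ∪ (bundleOf ν i \ treeItems T)).card =
      copiesInTree T k0 i + (bundleOf ν i \ treeItems T).card := by
  rw [card_union_of_disjoint (disjoint_sdiff.mono_left (h.bundleOf_subset i)), h.card_bundleOf,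
    copiesInTree]


/-- If the bundles of a matching of the tree maximize marginal utility, then swapping it into
`ν` preserves partial stability. -/
lemma IsMAT.partStable_of_margUtil_max (hT : IsMAT H ν k0 T) (hν : IsMTO cap ν)
    (hstab : PartStable v q ν p)
    (h : IsUnitMatching ((treeUnitBuyers T).erase k0) (treeItems T) ν')
    (hmax : ∀ i ∈ treeBuyers T k0, ∀ F ⊆ ({i} : Finset B) ×ˢ treeItems T,
      F.card = copiesInTree T k0 i →
        margUtil v q p ν T i F ≤ margUtil v q p ν T i ({i} ×ˢ bundleOf ν' i)) :
    PartStable v q ((ν \ T) ∪ ν') p := by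
  have h0 := hT.isUnitMatching_inter hν
  intro i A hA
  rw [hT.bundleOf_sdiff_union hν] at hA ⊢
  rw [h.card_union_bundleOf, ← h0.card_union_bundleOf, ← hT.bundleOf_eq hν] at hA
  refine (hstab i A hA).trans ?_
  by_cases hi : i ∈ treeBuyers T k0
  · have := hmax i hi ({i} ×ˢ bundleOf (ν ∩ T) i)
      (product_subset_product_right (h0.bundleOf_subset i))
      (by rw [card_product, card_singleton, one_mul, h0.card_bundleOf, copiesInTree])
    rw [margUtil, margUtil, image_snd_singleton_product, image_snd_singleton_product,
      ← hT.bundleOf_eq hν] at this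
    linarith
  · have hempty : ∀ ρ : Finset ((B × S) × S),
        IsUnitMatching ((treeUnitBuyers T).erase k0) (treeItems T) ρ → bundleOf ρ i = ∅ := by
      intro ρ hρ
      refine eq_empty_of_forall_notMem fun j hj => hi ?_
      obtain ⟨c, hc⟩ := mem_bundleOf.1 hj
      exact mem_treeBuyers.2 ⟨c, (hρ.edges _ hc).1⟩
    rw [hempty _ h]
    conv_lhs => rw [hT.bundleOf_eq hν, hempty _ h0]

lemma IsPSPM.isUnitMatching (h : IsPSPM cap v q p ν T k0 ν') :
    IsUnitMatching ((treeUnitBuyers T).erase k0) (treeItems T) ν' :=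
  ⟨h.edges, h.covers, h.unit, h.nodup⟩

/-- The projection of a partially stable perfect matching is a basis of the demand matroid. -/
lemma IsPSPM.proj_mem_demandBases (h : IsPSPM cap v q p ν T k0 ν')
    (hT : IsMAT H ν k0 T) (hν : IsMTO cap ν) :
    ν'.image (fun e => (e.1.1, e.2)) ∈ demandBases v q p ν T k0 := by
  have hm := h.isUnitMatching
  refine ⟨fun i => {i} ×ˢ bundleOf ν' i, fun i _ => ⟨?_, ?_, fun F hF hcard => ?_⟩, ?_⟩
  · exact product_subset_product_right (hm.bundleOf_subset i)
  · rw [card_product, card_singleton, one_mul, hm.card_bundleOf, copiesInTree]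
  · have := h.stable i (F.image Prod.snd ∪ (bundleOf ν i \ treeItems T)) (by
      rw [hT.bundleOf_sdiff_union hν, hm.card_union_bundleOf, ← hcard]
      exact (card_union_le _ _).trans (Nat.add_le_add_right card_image_le _))
    rw [hT.bundleOf_sdiff_union hν] at this
    rw [margUtil, margUtil, image_snd_singleton_product]
    linarith
  · ext ⟨i, j⟩
    simp only [mem_image, mem_biUnion, mem_product, mem_singleton, mem_bundleOf, Prod.exists,
      Prod.mk.injEq]
    constructor
    · rintro ⟨i, c, j, he, rfl, rfl⟩
      exact ⟨i, mem_treeBuyers.2 ⟨c, (h.edges _ he).1⟩, rfl, c, he⟩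
    · rintro ⟨_, -, rfl, c, he⟩
      exact ⟨_, c, _, he, rfl, rfl⟩

lemma IsPSPM.proj_mem_capIndep (h : IsPSPM cap v q p ν T k0 ν') :
    ν'.image (fun e => (e.1.1, e.2)) ∈ capIndep cap T k0 := by
  refine ⟨?_, fun j hj => ?_⟩
  · rintro _ he
    obtain ⟨e, he', rfl⟩ := mem_image.1 he
    exact mem_product.2 ⟨mem_treeBuyers.2 ⟨_, (h.edges e he').1⟩, (h.edges e he').2⟩
  · rw [filter_image_proj_card j (injOn_proj_of_nodup h.nodup)]
    exact (h.saturates j hj).le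

lemma card_eq_sum_of_mem_capIndep {E : Finset (B × S)} (hE : E ∈ capIndep cap T k0) :
    E.card = ∑ j ∈ treeItems T, (E.filter fun e => e.2 = j).card :=
  card_eq_sum_card_fiberwise fun _ he => (mem_product.1 (hE.1 he)).2

lemma IsPSPM.proj_maximal (h : IsPSPM cap v q p ν T k0 ν') {E : Finset (B × S)}
    (hE : E ∈ capIndep cap T k0) (hsub : ν'.image (fun e => (e.1.1, e.2)) ⊆ E) :
    E = ν'.image (fun e => (e.1.1, e.2)) := by
  refine (eq_of_subset_of_card_le hsub ?_).symm
  rw [card_eq_sum_of_mem_capIndep hE, card_eq_sum_of_mem_capIndep h.proj_mem_capIndep]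
  refine sum_le_sum fun j hj => (hE.2 j hj).trans ?_
  rw [filter_image_proj_card j (injOn_proj_of_nodup h.nodup)]
  exact (h.saturates j hj).ge

/-- A basis of the demand matroid has as many elements as there are non-root unit-buyers. -/
lemma card_of_mem_demandBases {E : Finset (B × S)} (hE : E ∈ demandBases v q p ν T k0) :
    E.card = ((treeUnitBuyers T).erase k0).card := by
  obtain ⟨f, hf, rfl⟩ := hE
  rw [card_biUnion, card_eq_sum_card_fiberwise (t := treeBuyers T k0) (f := Prod.fst)
    fun k hk => mem_image_of_mem _ hk]
  · exact sum_congr rfl fun i hi => (hf i hi).2.1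
  · intro i hi i' hi' hne
    refine disjoint_left.2 fun e he he' => hne ?_
    have h1 := (mem_product.1 ((hf i hi).1 he)).1
    have h2 := (mem_product.1 ((hf i' hi').1 he')).1
    rw [mem_singleton] at h1 h2
    exact h1.symm.trans h2

/-- A lift of a common basis of the demand and capacity matroids is a partially stable perfect
matching. -/
lemma IsMAT.isPSPM_of_lift (hT : IsMAT H ν k0 T) (hν : IsMTO cap ν)
    (hstab : PartStable v q ν p) (hfull : ∀ j ∈ treeItems T, itemDeg ν j = cap j)
    (hbasis : ν'.image (fun e => (e.1.1, e.2)) ∈ demandBases v q p ν T k0)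
    (hindep : ν'.image (fun e => (e.1.1, e.2)) ∈ capIndep cap T k0)
    (hunit : ∀ k : B × S, (ν'.filter fun e => e.1 = k).card ≤ 1)
    (hnodup : ∀ k k' : B × S, ∀ j : S, (k, j) ∈ ν' → (k', j) ∈ ν' → k.1 = k'.1 → k = k')
    (hmem : ∀ e ∈ ν', e.1 ∈ (treeUnitBuyers T).erase k0) :
    IsPSPM cap v q p ν T k0 ν' := by
  have hinj := injOn_proj_of_nodup hnodup
  have hcard := card_of_mem_demandBases hbasis
  have hm : IsUnitMatching ((treeUnitBuyers T).erase k0) (treeItems T) ν' := by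
    refine ⟨fun e he => ⟨hmem e he, ?_⟩, fun k hk => ?_, hunit, hnodup⟩
    · exact (mem_product.1 (hindep.1 (mem_image_of_mem _ he))).2
    · have himg : ν'.image Prod.fst = (treeUnitBuyers T).erase k0 := by
        refine eq_of_subset_of_card_le (image_subset_iff.2 hmem) ?_
        rw [card_image_of_injOn (injOn_fst_of_unit hunit), ← hcard]
        exact card_image_le
      rw [← himg] at hk
      obtain ⟨e, he, rfl⟩ := mem_image.1 hk
      exact ⟨e.2, he⟩
  have hle : ∀ j ∈ treeItems T, itemDeg ν' j ≤ cap j := fun j hj =>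
    (filter_image_proj_card j hinj).symm.le.trans (hindep.2 j hj)
  have hsum : ∑ j ∈ treeItems T, itemDeg ν' j = ∑ j ∈ treeItems T, cap j := by
    rw [← hm.card_eq_sum_itemDeg, hm.card_eq, hT.card_unitBuyers hν hfull]
  refine ⟨hm.edges, hm.covers, hunit, (sum_eq_sum_iff_of_le hle).1 hsum, hnodup,
    hT.partStable_of_margUtil_max hν hstab hm fun i hi F hF hFc => ?_⟩
  obtain ⟨f, hf, hEf⟩ := hbasis
  have hfi : ({i} : Finset B) ×ˢ bundleOf ν' i = f i := by
    refine (eq_of_subset_of_card_le (fun e he => ?_) ?_).symm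
    · have he1 : e.1 = i := by simpa using (mem_product.1 ((hf i hi).1 he)).1
      have he' : e ∈ ν'.image fun e => (e.1.1, e.2) := hEf ▸ mem_biUnion.2 ⟨i, hi, he⟩
      obtain ⟨e', he'', rfl⟩ := mem_image.1 he'
      subst he1
      exact mem_product.2 ⟨mem_singleton_self _, mem_bundleOf.2 ⟨_, he''⟩⟩
    · rw [card_product, card_singleton, one_mul, hm.card_bundleOf, (hf i hi).2.1, copiesInTree]
  rw [hfi]
  exact (hf i hi).2.2 F hF hFc

end TreeMatching

/-- A minimum weight common basis of the buyer demand matroid `M_B` and the item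
capacity matroid `M_S` lifts to a minimum weight partially stable perfect matching on
`U(T) ∖ {k0}` and `S(T)` (Lemma 5.3). -/
theorem min_weight_common_basis_lifts_to_min_weight_pspm
    [Fintype B] [Fintype S] [DecidableEq B] [DecidableEq S]
    (cap : S → ℕ) (v : B → Finset S → ℝ) (q : B → S → ℝ → ℝ)
    (hq0 : ∀ i j, q i j 0 = 0)
    (hqmono : ∀ i j, StrictMonoOn (q i j) (Set.Ici (0 : ℝ)))
    (hqcont : ∀ i j, Continuous (q i j))
    (hqnonneg : ∀ i j, ∀ x : ℝ, 0 ≤ x → 0 ≤ q i j x)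
    (hqpl : ∀ i j, PiecewiseLinear (q i j))
    (hq'pos : ∀ i j, ∀ x : ℝ, 0 ≤ x → 0 < rightDeriv (q i j) x)
    (hGS : ∀ i, QGS v q i)
    (p : S → ℝ) (hp : ∀ j, 0 ≤ p j)
    (ν : Finset ((B × S) × S)) (hν : IsMTO cap ν)
    (hfeas : FeasibleMTO cap ν p) (hstab : PartStable v q ν p)
    (k0 : B × S) (T : Finset ((B × S) × S))
    (hT : IsMAT (InMDG v q ν p) ν k0 T)
    (hfull : ∀ j ∈ treeItems T, itemDeg ν j = cap j)
    -- `μs` is a common basis of `M_B` and `M_S` …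
    (μs : Finset (B × S))
    (hbasisB : μs ∈ demandBases v q p ν T k0)
    (hindepS : μs ∈ capIndep cap T k0)
    (hbasisS : ∀ E ∈ capIndep cap T k0, μs ⊆ E → E = μs)
    -- … of minimum weight among all such common bases
    (hminwt : ∀ E ∈ demandBases v q p ν T k0, E ∈ capIndep cap T k0 →
      (∀ E' ∈ capIndep cap T k0, E ⊆ E' → E' = E) → wtB q p μs ≤ wtB q p E)
    -- `νs` is a lift of `μs` using the non-root unit-buyers of the tree
    (νs : Finset ((B × S) × S))
    (hlift_unit : ∀ k : B × S, (νs.filter fun e => e.1 = k).card ≤ 1)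
    (hlift_nodup : ∀ k k' : B × S, ∀ j : S, (k, j) ∈ νs → (k', j) ∈ νs →
      k.1 = k'.1 → k = k')
    (hlift_mem : ∀ e ∈ νs, e.1 ∈ (treeUnitBuyers T).erase k0)
    (hlift_proj : νs.image (fun e => (e.1.1, e.2)) = μs)
    (hlift_card : νs.card = μs.card) :
    IsPSPM cap v q p ν T k0 νs ∧
      ∀ ν' : Finset ((B × S) × S), IsPSPM cap v q p ν T k0 ν' →
        wtU q p νs ≤ wtU q p ν' := by
  subst hlift_proj
  have hinj := injOn_proj_of_nodup hlift_nodup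
  refine ⟨hT.isPSPM_of_lift hν hstab hfull hbasisB hindepS hlift_unit hlift_nodup hlift_mem,
    fun ν' h => ?_⟩
  rw [wtU_eq_wtB q p hinj, wtU_eq_wtB q p (injOn_proj_of_nodup h.nodup)]
  exact hminwt _ (h.proj_mem_demandBases hT hν) h.proj_mem_capIndep
    fun _ hE hsub => h.proj_maximal hE hsub
end
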